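/- arXiv:2304.03484 — 3 statements merged into one kernel-verified Lean document; each statement's English description precedes it below -/
import Mathlib

section
/- Let λ ∈ (0,1] and let C ⊆ ℝ² be a λ-fat compact convex set with nonempty interior, i.e., width(C) ≥ λ·diam₂(C). Then for any two points s, t ∈ frontier(C) with s ≠ t, there exists a continuous path γ : [0,1] → ℝ² with γ(0) = s, γ(1) = t, image of γ contained in frontier(C), and length at most min{π/λ, 2·(1/λ + 1)}·dist(s,t). (Equivalently, the geometric dilation of C satisfies δ(C) ≤ min{π·λ⁻¹, 2(λ⁻¹ + 1)} = O(λ⁻¹).) -/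
open Set Metric ENNReal RealInnerProductSpace

noncomputable section

/-- The Euclidean plane. -/
abbrev Plane := EuclideanSpace ℝ (Fin 2)

/-- A convex polygon: the convex hull of a nonempty finite point set. -/
def IsConvexPolygon (Q : Set Plane) : Prop :=
  ∃ S : Finset Plane, S.Nonempty ∧ Q = convexHull ℝ (S : Set Plane)

/-- `γ` is a continuous path from `s` to `t` (parametrized on `[0,1]`) with image in `P`. -/
def IsPathIn (P : Set Plane) (γ : ℝ → Plane) (s t : Plane) : Prop :=
  ContinuousOn γ (Set.Icc 0 1) ∧ γ 0 = s ∧ γ 1 = t ∧ Set.MapsTo γ (Set.Icc 0 1) P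

/-- Length of a path: its total variation on `[0,1]`. -/
def pathLen (γ : ℝ → Plane) : ℝ≥0∞ := eVariationOn γ (Set.Icc 0 1)

/-- Geodesic distance inside `P`: infimum of lengths of continuous paths
from `s` to `t` contained in `P`. -/
def geod (P : Set Plane) (s t : Plane) : ℝ≥0∞ :=
  ⨅ γ : {γ : ℝ → Plane // IsPathIn P γ s t}, pathLen γ.1

/-- Geodesic diameter of `P`. -/
def geodDiam (P : Set Plane) : ℝ≥0∞ :=
  ⨆ s ∈ P, ⨆ t ∈ P, geod P s t

/-- The width of a planar set: the minimum, over unit directions `v`,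
of the extent of `C` in direction `v`. -/
def setWidth (C : Set Plane) : ℝ :=
  ⨅ v : {v : Plane // ‖v‖ = 1},
    (sSup ((fun x => ⟪x, v.1⟫) '' C) - sInf ((fun x => ⟪x, v.1⟫) '' C))
theorem eVariationOn_le_of_crossing_of_le {f : ℝ → ℝ}
    (h : ∀ a b c d : ℝ, 0 ≤ a → a ≤ b → b ≤ c → c ≤ d → d ≤ 1 →
      min (f a) (f c) ≤ max (f b) (f d) ∧ min (f b) (f d) ≤ max (f a) (f c))
    {i j : ℝ} (hi : 0 ≤ i) (hij : i ≤ j) (hj : j ≤ 1)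
    (hmin : ∀ x ∈ Icc (0 : ℝ) 1, f i ≤ f x) (hmax : ∀ x ∈ Icc (0 : ℝ) 1, f x ≤ f j) :
    eVariationOn f (Icc 0 1) ≤ ENNReal.ofReal (2 * (f j - f i) - |f 1 - f 0|) := by
  have anti₁ : AntitoneOn f (Icc 0 i) := by
    intro k hk l hl hkl
    have h1 := (h k l i j hk.1 hkl hl.2 hij hj).2
    have h2 := hmax l ⟨hl.1, by linarith [hl.2]⟩
    have h3 := hmin k ⟨hk.1, by linarith [hk.2]⟩
    rwa [min_eq_left h2, max_eq_left h3] at h1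
  have mono : MonotoneOn f (Icc i j) := by
    intro k hk l hl hkl
    have h1 := (h i k l j hi hk.1 hkl hl.2 hj).2
    have h2 := hmax k ⟨by linarith [hk.1], by linarith [hk.2]⟩
    have h3 := hmin l ⟨by linarith [hl.1], by linarith [hl.2]⟩
    rwa [min_eq_left h2, max_eq_right h3] at h1
  have anti₂ : AntitoneOn f (Icc j 1) := by
    intro k hk l hl hkl
    have h1 := (h i j k l hi hij hk.1 hkl hl.2).2
    have h2 := hmax l ⟨by linarith [hl.1], by linarith [hl.2]⟩
    have h3 := hmin k ⟨by linarith [hk.1], by linarith [hk.2]⟩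
    rwa [min_eq_right h2, max_eq_right h3] at h1
  have hends : f 0 ≤ f 1 := by
    have h1 := (h 0 i j 1 le_rfl hi hij hj le_rfl).1
    have h2 := hmax 0 ⟨by linarith, by linarith⟩
    have h3 := hmin 1 ⟨by linarith, by linarith⟩
    rwa [min_eq_left h2, max_eq_right h3] at h1
  have e1 := eVariationOn.Icc_add_Icc f (s := univ) hij hj (mem_univ _)
  have e2 := eVariationOn.Icc_add_Icc f (s := univ) hi (hij.trans hj) (mem_univ _)
  simp only [univ_inter] at e1 e2
  have anti_le : ∀ {a b : ℝ}, a ≤ b → AntitoneOn f (Icc a b) →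
      eVariationOn f (Icc a b) ≤ ENNReal.ofReal (f a - f b) := by
    intro a b hab hf
    have := (hf.neg.eVariationOn_eq (a := a) (b := b) (left_mem_Icc.2 hab) (right_mem_Icc.2 hab)).le
    rw [inter_self] at this
    have hn : eVariationOn (fun x => -f x) (Icc a b) = eVariationOn f (Icc a b) := by
      simp [eVariationOn, edist_neg_neg]
    rw [← hn]
    refine this.trans (le_of_eq ?_)
    congr 1
    ring
  have l1 := anti_le hi anti₁
  have l3 := anti_le hj anti₂
  have l2 := (mono.eVariationOn_eq (left_mem_Icc.2 hij) (right_mem_Icc.2 hij)).le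
  rw [inter_self] at l2
  rw [← e2, ← e1]
  refine (add_le_add l1 (add_le_add l2 l3)).trans ?_
  have := hmin 0 ⟨le_rfl, zero_le_one⟩
  have := hmin j ⟨by linarith, by linarith⟩
  have := hmax 1 ⟨zero_le_one, le_rfl⟩
  rw [← ENNReal.ofReal_add (by linarith) (by linarith),
    ← ENNReal.ofReal_add (by linarith) (by linarith), abs_of_nonneg (by linarith)]
  apply ENNReal.ofReal_le_ofReal
  linarith

theorem eVariationOn_le_of_crossing {f : ℝ → ℝ} (hf : ContinuousOn f (Icc 0 1))
    (h : ∀ a b c d : ℝ, 0 ≤ a → a ≤ b → b ≤ c → c ≤ d → d ≤ 1 →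
      min (f a) (f c) ≤ max (f b) (f d) ∧ min (f b) (f d) ≤ max (f a) (f c)) :
    ∃ i ∈ Icc (0 : ℝ) 1, ∃ j ∈ Icc (0 : ℝ) 1,
      eVariationOn f (Icc 0 1) ≤ ENNReal.ofReal (2 * (f j - f i) - |f 1 - f 0|) := by
  obtain ⟨i, hi, hmin⟩ := isCompact_Icc.exists_isMinOn (nonempty_Icc.2 zero_le_one) hf
  obtain ⟨j, hj, hmax⟩ := isCompact_Icc.exists_isMaxOn (nonempty_Icc.2 zero_le_one) hf
  refine ⟨i, hi, j, hj, ?_⟩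
  rcases le_total i j with hij | hji
  · exact eVariationOn_le_of_crossing_of_le h hi.1 hij hj.2 (fun x hx => hmin hx) (fun x hx => hmax hx)
  · have key := eVariationOn_le_of_crossing_of_le (f := fun x => -f x) (i := j) (j := i) ?_ hj.1 hji
      hi.2 (fun x hx => neg_le_neg (hmax hx)) (fun x hx => neg_le_neg (hmin hx))
    · have hn : eVariationOn (fun x => -f x) (Icc 0 1) = eVariationOn f (Icc 0 1) := by
        simp [eVariationOn, edist_neg_neg]
      rw [hn] at key
      refine key.trans (le_of_eq ?_)
      congr 1
      rw [show -f 1 - -f 0 = -(f 1 - f 0) by ring, abs_neg]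
      ring
    · intro a b c d h0 hab hbc hcd hd
      have := h a b c d h0 hab hbc hcd hd
      simp only [min_neg_neg, max_neg_neg, neg_le_neg_iff]
      exact ⟨this.2, this.1⟩

theorem min_le_max_of_radial {A B C D g₀ α β α' β' : ℝ} (hα : 0 ≤ α) (hβ : 0 ≤ β)
    (hαβ : 1 ≤ α + β) (hα' : 0 ≤ α') (hβ' : 0 ≤ β') (hαβ' : 1 ≤ α' + β')
    (e : B - g₀ = α * (A - g₀) + β * (C - g₀)) (e' : C - g₀ = α' * (B - g₀) + β' * (D - g₀)) :
    min A C ≤ max B D := by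
  by_contra! hlt
  obtain ⟨m, hm, hm'⟩ := exists_between hlt
  obtain ⟨hB, hD⟩ := max_lt_iff.1 hm
  obtain ⟨hA, hC⟩ := lt_min_iff.1 hm'
  rcases le_total g₀ m with hg | hg
  · nlinarith [mul_nonneg hα (sub_nonneg.2 hA.le), mul_nonneg hβ (sub_nonneg.2 hC.le),
      mul_nonneg (sub_nonneg.2 hg) (sub_nonneg.2 hαβ)]
  · nlinarith [mul_nonneg hα' (sub_nonneg.2 hB.le), mul_nonneg hβ' (sub_nonneg.2 hD.le),
      mul_nonneg (sub_nonneg.2 hg) (sub_nonneg.2 hαβ')]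

theorem crossing_of_radial {f : ℝ → ℝ} {g₀ : ℝ}
    (h : ∀ i j k : ℝ, 0 ≤ i → i ≤ j → j ≤ k → k ≤ 1 → ∃ α β : ℝ, 0 ≤ α ∧ 0 ≤ β ∧ 1 ≤ α + β ∧
      f j - g₀ = α * (f i - g₀) + β * (f k - g₀)) (a b c d : ℝ) (ha : 0 ≤ a) (hab : a ≤ b)
    (hbc : b ≤ c) (hcd : c ≤ d) (hd : d ≤ 1) :
    min (f a) (f c) ≤ max (f b) (f d) ∧ min (f b) (f d) ≤ max (f a) (f c) := by
  obtain ⟨α, β, hα, hβ, hαβ, e⟩ := h a b c ha hab hbc (hcd.trans hd)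
  obtain ⟨α', β', hα', hβ', hαβ', e'⟩ := h b c d (ha.trans hab) hbc hcd hd
  refine ⟨min_le_max_of_radial hα hβ hαβ hα' hβ' hαβ' e e', ?_⟩
  have := min_le_max_of_radial (A := -f a) (B := -f b) (C := -f c) (D := -f d) (g₀ := -g₀)
    hα hβ hαβ hα' hβ' hαβ' (by linear_combination -e) (by linear_combination -e')
  rwa [min_neg_neg, max_neg_neg, neg_le_neg_iff] at this

/-- The part of the boundary of a convex body seen from an interior point through a chord. -/
theorem exists_radial_path {E : Type*} [NormedAddCommGroup E] [NormedSpace ℝ E] {K : Set E}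
    (hK : Bornology.IsBounded K) (hconv : Convex ℝ K) (hclosed : IsClosed K)
    (h0 : K ∈ nhds 0) {S T : E} (hS : S ∈ frontier K) (hT : T ∈ frontier K)
    (hST : ∀ a ∈ Icc (0 : ℝ) 1, (1 - a) • S + a • T ≠ 0) :
    ∃ γ : ℝ → E, ContinuousOn γ (Icc 0 1) ∧ γ 0 = S ∧ γ 1 = T ∧
      MapsTo γ (Icc 0 1) (frontier K) ∧
      (∀ a ∈ Icc (0 : ℝ) 1, ∃ r : ℝ, 1 ≤ r ∧ γ a = r • ((1 - a) • S + a • T)) ∧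
      ∀ i j k : ℝ, 0 ≤ i → i ≤ j → j ≤ k → k ≤ 1 → ∃ α β : ℝ, 0 ≤ α ∧ 0 ≤ β ∧ 1 ≤ α + β ∧
        γ j = α • γ i + β • γ k := by
  have habs : Absorbent ℝ K := absorbent_nhds_zero h0
  have hvb : Bornology.IsVonNBounded ℝ K := (NormedSpace.isVonNBounded_iff ℝ).2 hK
  set v : ℝ → E := fun a => (1 - a) • S + a • T with hv
  have hpos : ∀ a ∈ Icc (0 : ℝ) 1, 0 < gauge K (v a) := fun a ha =>
    (gauge_pos habs hvb).2 (hST a ha)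
  have hgS : gauge K S = 1 := (gauge_eq_one_iff_mem_frontier hconv h0).2 hS
  have hgT : gauge K T = 1 := (gauge_eq_one_iff_mem_frontier hconv h0).2 hT
  have hcv : Continuous v := by fun_prop
  have hg : Continuous fun a => gauge K (v a) := (continuous_gauge hconv h0).comp hcv
  refine ⟨fun a => (gauge K (v a))⁻¹ • v a, ?_, ?_, ?_, ?_, ?_, ?_⟩
  · exact (hg.continuousOn.inv₀ fun a ha => (hpos a ha).ne').smul hcv.continuousOn
  · simp [hv, hgS]
  · simp [hv, hgT]
  · intro a ha
    rw [← gauge_eq_one_iff_mem_frontier hconv h0,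
      gauge_smul_of_nonneg (inv_nonneg.2 (hpos a ha).le), smul_eq_mul]
    exact inv_mul_cancel₀ (hpos a ha).ne'
  · intro a ha
    refine ⟨_, ?_, rfl⟩
    refine (one_le_inv₀ (hpos a ha)).2 (gauge_le_one_of_mem ?_)
    exact hconv (hclosed.frontier_subset hS) (hclosed.frontier_subset hT)
      (by linarith [ha.2]) ha.1 (by ring)
  · intro i j k hi hij hjk hk
    rcases (hij.trans hjk).eq_or_lt with rfl | hik
    · obtain rfl := le_antisymm hij hjk
      exact ⟨1, 0, by norm_num, by norm_num, by norm_num, by simp⟩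
    have pi := hpos i ⟨hi, by linarith⟩
    have pj := hpos j ⟨by linarith, by linarith⟩
    have pk := hpos k ⟨by linarith, hk⟩
    have hd : 0 < k - i := by linarith
    set a := (k - j) / (k - i) with ha
    set b := (j - i) / (k - i) with hb
    have ha0 : 0 ≤ a := div_nonneg (by linarith) hd.le
    have hb0 : 0 ≤ b := div_nonneg (by linarith) hd.le
    have hab : a + b = 1 := by rw [ha, hb]; field_simp; ring
    have hj : a * i + b * k = j := by rw [ha, hb]; field_simp; ring
    have hvj : v j = a • v i + b • v k := by
      have hba : b = 1 - a := by linarith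
      simp only [hv]
      rw [← hj, hba]
      module
    have hle : gauge K (v j) ≤ a * gauge K (v i) + b * gauge K (v k) := by
      rw [hvj]
      refine (gauge_add_le hconv habs _ _).trans (le_of_eq ?_)
      rw [gauge_smul_of_nonneg ha0, gauge_smul_of_nonneg hb0, smul_eq_mul, smul_eq_mul]
    refine ⟨a * gauge K (v i) / gauge K (v j), b * gauge K (v k) / gauge K (v j), by positivity,
      by positivity, ?_, ?_⟩
    · rw [← add_div]
      exact (one_le_div pj).2 hle
    · simp only [smul_smul]
      nth_rewrite 2 [hvj]
      rw [smul_add, smul_smul, smul_smul]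
      congr 2 <;> field_simp

theorem two_mul_sub_le_of_chords {α δ P θ a θ' a' Y Y' R : ℝ} (hα : 0 < α) (hα1 : α < 1)
    (hδ : 0 ≤ δ) (hθ : 0 ≤ θ) (hθ' : 0 ≤ θ') (ha : 0 ≤ a) (ha' : 0 ≤ a')
    (h : α * a + θ ≤ α) (h' : α * a' + θ' ≤ α)
    (hY : (1 - θ) * Y = a * δ - θ * P) (hY' : (1 - θ') * Y' = a' * δ - θ' * P)
    (h1 : Y - P ≤ R) (h2 : Y - (P + δ / α) ≤ R) (h4 : P + δ / α - Y' ≤ R)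
    (h5 : δ / α ≤ R) : 2 * (Y - Y') - δ ≤ 2 * α * R := by
  obtain ⟨e, rfl⟩ : ∃ e, δ = α * e := ⟨δ / α, by field_simp⟩
  rw [mul_div_cancel_left₀ _ hα.ne'] at *
  have he : 0 ≤ e := by
    by_contra! hh
    nlinarith
  have hθ1 : 0 < 1 - θ := by nlinarith
  have hθ1' : 0 < 1 - θ' := by nlinarith
  have A1 : α * a * e ≤ (α - θ) * e := mul_le_mul_of_nonneg_right (by linarith) he
  have A1' : α * a' * e ≤ (α - θ') * e := mul_le_mul_of_nonneg_right (by linarith) he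
  have hRn : 0 ≤ R := he.trans h5
  rcases le_or_gt P 0 with hP | hP
  · have y0 : 0 ≤ Y' := by
      by_contra! hh
      nlinarith [mul_pos hθ1' (neg_pos.2 hh), mul_nonneg hθ' (neg_nonneg.2 hP),
        mul_nonneg (mul_nonneg hα.le ha') he]
    rcases le_total (P + e) (α * e) with hQ | hQ
    · have : Y * (1 - α) ≤ - (α * P) := by
        refine le_of_mul_le_mul_left ?_ hθ1
        have : (1 - θ) * Y ≤ (α - θ) * e - θ * P := by linarith
        nlinarith [mul_le_mul_of_nonneg_right this (by linarith : 0 ≤ 1 - α),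
          mul_le_mul_of_nonneg_left hQ (by nlinarith : 0 ≤ α - θ)]
      nlinarith
    · have : Y ≤ α * e := by
        refine le_of_mul_le_mul_left ?_ hθ1
        nlinarith
      nlinarith
  · have : Y ≤ α * e := by
      refine le_of_mul_le_mul_left ?_ hθ1
      nlinarith [mul_nonneg (mul_nonneg hθ he) (by linarith : 0 ≤ 1 - α), mul_nonneg hθ hP.le]
    have : -Y' * (1 - α) ≤ α * P := by
      refine le_of_mul_le_mul_left ?_ hθ1'
      have : (1 - θ') * -Y' ≤ θ' * P := by nlinarith [mul_nonneg (mul_nonneg hα.le ha') he]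
      have h6 : θ' ≤ α := by nlinarith
      nlinarith [mul_le_mul_of_nonneg_right this (by linarith : 0 ≤ 1 - α)]
    nlinarith

theorem integral_abs_cos_sub (φ : ℝ) : ∫ θ in (0 : ℝ)..Real.pi, |Real.cos (θ - φ)| = 2 := by
  have hper : Function.Periodic (fun x => |Real.cos x|) Real.pi := fun x => by
    simp [Real.cos_add_pi]
  rw [intervalIntegral.integral_comp_sub_right (fun x => |Real.cos x|)]
  have := hper.intervalIntegral_add_eq (0 - φ) (-(Real.pi / 2))
  rw [show Real.pi - φ = 0 - φ + Real.pi by ring, this,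
    show -(Real.pi / 2) + Real.pi = Real.pi / 2 by ring]
  rw [intervalIntegral.integral_congr (g := Real.cos)]
  · simp
    norm_num
  · intro x hx
    rw [uIcc_of_le (by linarith [Real.pi_pos])] at hx
    exact abs_of_nonneg (Real.cos_nonneg_of_mem_Icc hx)

/-- The unit vector with polar angle `θ`. -/
noncomputable def polarUnit (θ : ℝ) : Plane := !₂[Real.cos θ, Real.sin θ]

theorem norm_polarUnit (θ : ℝ) : ‖polarUnit θ‖ = 1 := by
  simp [polarUnit, EuclideanSpace.norm_eq]

theorem continuous_polarUnit : Continuous polarUnit := by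
  unfold polarUnit
  fun_prop

theorem integral_abs_inner_polarUnit (x : Plane) :
    ∫ θ in (0 : ℝ)..Real.pi, |⟪x, polarUnit θ⟫| = 2 * ‖x‖ := by
  let z : ℂ := ⟨x 0, x 1⟩
  have hz : ‖z‖ = ‖x‖ := by
    rw [EuclideanSpace.norm_eq, Complex.norm_eq_sqrt_sq_add_sq]
    simp [z]
  have : ∀ θ, |⟪x, polarUnit θ⟫| = ‖x‖ * |Real.cos (θ - z.arg)| := by
    intro θ
    suffices h : ⟪x, polarUnit θ⟫ = ‖x‖ * Real.cos (θ - z.arg) by rw [h, abs_mul, abs_norm]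
    have h0 : x 0 = ‖z‖ * Real.cos z.arg := (Complex.norm_mul_cos_arg z).symm
    have h1 : x 1 = ‖z‖ * Real.sin z.arg := (Complex.norm_mul_sin_arg z).symm
    rw [Real.cos_sub]
    simp only [polarUnit, PiLp.inner_apply, Fin.sum_univ_two]
    simp [h0, h1, hz]
    ring_nf
  simp_rw [this]
  rw [intervalIntegral.integral_const_mul, integral_abs_cos_sub]
  ring

theorem eVariationOn_le_of_sum_norm_le {γ : ℝ → Plane} {s : Set ℝ} {L : ℝ}
    (h : ∀ (n : ℕ) (τ : ℕ → ℝ), Monotone τ → (∀ i, τ i ∈ s) →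
      ∑ i ∈ Finset.range n, ‖γ (τ (i + 1)) - γ (τ i)‖ ≤ L) :
    eVariationOn γ s ≤ ENNReal.ofReal L := by
  refine iSup_le fun p => ?_
  simp only [edist_dist, dist_eq_norm]
  rw [← ENNReal.ofReal_sum_of_nonneg fun _ _ => norm_nonneg _]
  exact ENNReal.ofReal_le_ofReal (h p.1 p.2.1 p.2.2.1 p.2.2.2)

theorem sum_abs_inner_le {γ : ℝ → Plane} {s : Set ℝ} {u : Plane} {B : ℝ} (hB : 0 ≤ B)
    (h : eVariationOn (fun τ => ⟪γ τ, u⟫) s ≤ ENNReal.ofReal B) (n : ℕ) {τ : ℕ → ℝ}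
    (hτ : Monotone τ) (hs : ∀ i, τ i ∈ s) :
    ∑ i ∈ Finset.range n, |⟪γ (τ (i + 1)) - γ (τ i), u⟫| ≤ B := by
  have := (eVariationOn.sum_le (f := fun τ => ⟪γ τ, u⟫) (n := n) hτ hs).trans h
  simp only [edist_dist, dist_eq_norm, ← inner_sub_left, Real.norm_eq_abs] at this
  rwa [← ENNReal.ofReal_sum_of_nonneg fun _ _ => abs_nonneg _, ENNReal.ofReal_le_ofReal_iff hB]
    at this

/-- Cauchy's formula turns a bound on all one-dimensional projections into a length bound. -/
theorem eVariationOn_le_pi_of_projections {γ : ℝ → Plane} {s : Set ℝ} {B : ℝ} (hB : 0 ≤ B)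
    (h : ∀ u : Plane, ‖u‖ = 1 → eVariationOn (fun τ => ⟪γ τ, u⟫) s ≤ ENNReal.ofReal (2 * B)) :
    eVariationOn γ s ≤ ENNReal.ofReal (Real.pi * B) := by
  refine eVariationOn_le_of_sum_norm_le fun n τ hτ hs => ?_
  have key : 2 * ∑ i ∈ Finset.range n, ‖γ (τ (i + 1)) - γ (τ i)‖
      = ∫ θ in (0 : ℝ)..Real.pi,
        ∑ i ∈ Finset.range n, |⟪γ (τ (i + 1)) - γ (τ i), polarUnit θ⟫| := by
    rw [intervalIntegral.integral_finsetSum, Finset.mul_sum]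
    · simp_rw [integral_abs_inner_polarUnit]
    · intro i _
      refine Continuous.intervalIntegrable ?_ _ _
      exact (continuous_const.inner continuous_polarUnit).abs
  have : ∫ θ in (0 : ℝ)..Real.pi,
        ∑ i ∈ Finset.range n, |⟪γ (τ (i + 1)) - γ (τ i), polarUnit θ⟫|
      ≤ ∫ θ in (0 : ℝ)..Real.pi, 2 * B := by
    refine intervalIntegral.integral_mono_on Real.pi_pos.le ?_ (by simp) fun θ _ =>
      sum_abs_inner_le (by linarith) (h _ (norm_polarUnit θ)) n hτ hs
    refine Continuous.intervalIntegrable ?_ _ _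
    exact continuous_finsetSum _ fun i _ => (continuous_const.inner continuous_polarUnit).abs
  simp at this
  nlinarith

/-- The vector `x` rotated by a right angle. -/
noncomputable def rightRot (x : Plane) : Plane := !₂[-x 1, x 0]

theorem norm_rightRot (x : Plane) : ‖rightRot x‖ = ‖x‖ := by
  simp [rightRot, EuclideanSpace.norm_eq, add_comm]

theorem norm_le_abs_inner_add {u : Plane} (hu : ‖u‖ = 1) (x : Plane) :
    ‖x‖ ≤ |⟪x, u⟫| + |⟪x, rightRot u⟫| := by
  have hu2 : u 0 ^ 2 + u 1 ^ 2 = 1 := by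
    have := EuclideanSpace.real_norm_sq_eq u
    rw [hu] at this
    simpa using this.symm
  refine abs_le_of_sq_le_sq' ?_ (by positivity) |>.2
  rw [EuclideanSpace.real_norm_sq_eq]
  have e1 : ⟪x, u⟫ = x 0 * u 0 + x 1 * u 1 := by
    simp [PiLp.inner_apply, Fin.sum_univ_two, mul_comm]
  have e2 : ⟪x, rightRot u⟫ = x 1 * u 0 - x 0 * u 1 := by
    simp [PiLp.inner_apply, Fin.sum_univ_two, mul_comm, rightRot]
    ring
  have := mul_nonneg (abs_nonneg ⟪x, u⟫) (abs_nonneg ⟪x, rightRot u⟫)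
  have s1 := sq_abs ⟪x, u⟫
  have s2 := sq_abs ⟪x, rightRot u⟫
  have : (x 0 * u 0 + x 1 * u 1) ^ 2 + (x 1 * u 0 - x 0 * u 1) ^ 2 = x 0 ^ 2 + x 1 ^ 2 := by
    linear_combination (x 0 ^ 2 + x 1 ^ 2) * hu2
  rw [e1] at s1
  rw [e2] at s2
  simp only [Fin.sum_univ_two]
  rw [e1, e2] at *
  nlinarith

theorem eVariationOn_le_add_of_projections {γ : ℝ → Plane} {s : Set ℝ} {u : Plane}
    (hu : ‖u‖ = 1) {B B' : ℝ} (hB : 0 ≤ B) (hB' : 0 ≤ B')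
    (h : eVariationOn (fun τ => ⟪γ τ, u⟫) s ≤ ENNReal.ofReal B)
    (h' : eVariationOn (fun τ => ⟪γ τ, rightRot u⟫) s ≤ ENNReal.ofReal B') :
    eVariationOn γ s ≤ ENNReal.ofReal (B + B') := by
  refine eVariationOn_le_of_sum_norm_le fun n τ hτ hs => ?_
  refine (Finset.sum_le_sum fun i _ => norm_le_abs_inner_add hu _).trans ?_
  rw [Finset.sum_add_distrib]
  exact add_le_add (sum_abs_inner_le hB h n hτ hs) (sum_abs_inner_le hB' h' n hτ hs)

/-- The extent of `C` in direction `u`. -/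
noncomputable def extent (C : Set Plane) (u : Plane) : ℝ :=
  sSup ((fun x => ⟪x, u⟫) '' C) - sInf ((fun x => ⟪x, u⟫) '' C)

section Extent

variable {C : Set Plane}

theorem isCompact_image_inner (hC : IsCompact C) (u : Plane) :
    IsCompact ((fun x => ⟪x, u⟫) '' C) :=
  hC.image (by fun_prop)

theorem inner_sub_le_extent (hC : IsCompact C) (u : Plane) {x y : Plane} (hx : x ∈ C)
    (hy : y ∈ C) : ⟪x - y, u⟫ ≤ extent C u := by
  rw [inner_sub_left]
  exact sub_le_sub (le_csSup (isCompact_image_inner hC u).bddAbove (mem_image_of_mem _ hx))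
    (csInf_le (isCompact_image_inner hC u).bddBelow (mem_image_of_mem _ hy))

theorem exists_inner_sub_eq_extent (hC : IsCompact C) (hne : C.Nonempty) (u : Plane) :
    ∃ x ∈ C, ∃ y ∈ C, ⟪x - y, u⟫ = extent C u := by
  obtain ⟨x, hx, hx'⟩ := (isCompact_image_inner hC u).sSup_mem (hne.image _)
  obtain ⟨y, hy, hy'⟩ := (isCompact_image_inner hC u).sInf_mem (hne.image _)
  refine ⟨x, hx, y, hy, ?_⟩
  rw [inner_sub_left, extent, ← hx', ← hy']

theorem extent_nonneg (hC : IsCompact C) (hne : C.Nonempty) (u : Plane) : 0 ≤ extent C u := by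
  obtain ⟨x, hx⟩ := hne
  simpa using inner_sub_le_extent hC u hx hx

theorem extent_le_diam (hC : IsCompact C) (hne : C.Nonempty) {u : Plane} (hu : ‖u‖ = 1) :
    extent C u ≤ Metric.diam C := by
  obtain ⟨x, hx, y, hy, h⟩ := exists_inner_sub_eq_extent hC hne u
  rw [← h]
  refine (real_inner_le_norm _ _).trans ?_
  rw [hu, mul_one, ← dist_eq_norm]
  exact Metric.dist_le_diam_of_mem hC.isBounded hx hy

theorem setWidth_le_extent (hC : IsCompact C) (hne : C.Nonempty) {u : Plane} (hu : ‖u‖ = 1) :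
    setWidth C ≤ extent C u :=
  ciInf_le (f := fun v : {v : Plane // ‖v‖ = 1} => extent C v.1)
    ⟨0, by rintro _ ⟨v, rfl⟩; exact extent_nonneg hC hne _⟩ ⟨u, hu⟩

theorem exists_extent_lt (C : Set Plane) {ε : ℝ} (hε : 0 < ε) :
    ∃ u : Plane, ‖u‖ = 1 ∧ extent C u < setWidth C + ε := by
  have : Nonempty {v : Plane // ‖v‖ = 1} := ⟨⟨polarUnit 0, norm_polarUnit 0⟩⟩
  obtain ⟨u, hu⟩ := exists_lt_of_ciInf_lt (lt_add_of_pos_right (setWidth C) hε)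
  exact ⟨u.1, u.2, hu⟩

/-- A planar convex body has in every direction a chord as long as its width. -/
theorem exists_chord (hC : IsCompact C) (hconv : Convex ℝ C) (hne : C.Nonempty)
    (hw : 0 ≤ setWidth C) {v : Plane} (hv : ‖v‖ = 1) :
    ∃ p ∈ C, p + setWidth C • v ∈ C := by
  by_contra! hno
  set w := setWidth C
  have hdisj : Disjoint C ((fun x => x + -(w • v)) ⁻¹' C) := by
    rw [Set.disjoint_left]
    intro x hx hx'
    exact hno _ hx' (by simpa using hx)
  obtain ⟨f, a, b, hfa, hab, hfb⟩ := geometric_hahn_banach_compact_closed hconv hC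
    (hconv.translate_preimage_left (-(w • v))) (hC.isClosed.preimage (by fun_prop)) hdisj
  obtain ⟨n, rfl⟩ := (InnerProductSpace.toDual ℝ Plane).surjective f
  simp only [InnerProductSpace.toDual_apply_apply] at hfa hfb
  have hlt : ∀ x ∈ C, ∀ y ∈ C, ⟪x - y, n⟫ < w * ‖n‖ := by
    intro x hx y hy
    have h1 := hfa x hx
    have h2 := hfb (y + w • v) (by simpa using hy)
    rw [inner_add_right, inner_smul_right] at h2
    have h3 : ⟪n, v⟫ ≤ ‖n‖ := by simpa [hv] using real_inner_le_norm n v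
    rw [inner_sub_left, real_inner_comm n x, real_inner_comm n y]
    nlinarith [mul_le_mul_of_nonneg_left h3 hw]
  have hn : 0 < ‖n‖ := by
    obtain ⟨x, hx⟩ := hne
    have := hlt x hx x hx
    rw [sub_self, inner_zero_left] at this
    exact pos_of_mul_pos_right this hw
  have hu : ‖‖n‖⁻¹ • n‖ = 1 := by
    rw [norm_smul, norm_inv, norm_norm, inv_mul_cancel₀ hn.ne']
  obtain ⟨x, hx, y, hy, h⟩ := exists_inner_sub_eq_extent hC hne (‖n‖⁻¹ • n)
  have h1 := setWidth_le_extent hC hne hu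
  rw [← h, inner_smul_right, inv_mul_eq_div, le_div_iff₀ hn] at h1
  exact absurd h1 (hlt x hx y hy).not_ge

end Extent

theorem inner_rightRot_self (x : Plane) : ⟪x, rightRot x⟫ = 0 := by
  simp [PiLp.inner_apply, Fin.sum_univ_two, rightRot]
  ring

theorem exists_smul_of_inner_rightRot_eq_zero {e x : Plane} (he : e ≠ 0)
    (h : ⟪x, rightRot e⟫ = 0) : ∃ a : ℝ, x = a • e := by
  have hpos : e 0 ^ 2 + e 1 ^ 2 ≠ 0 := by
    intro h0
    apply he
    have h1 : e 0 = 0 := by nlinarith [sq_nonneg (e 0), sq_nonneg (e 1)]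
    have h2 : e 1 = 0 := by nlinarith [sq_nonneg (e 0), sq_nonneg (e 1)]
    ext i
    fin_cases i <;> simp [h1, h2]
  simp [PiLp.inner_apply, Fin.sum_univ_two, rightRot] at h
  refine ⟨(x 0 * e 0 + x 1 * e 1) / (e 0 ^ 2 + e 1 ^ 2), ?_⟩
  ext i
  fin_cases i
  · simp
    field_simp
    linear_combination (-e 1) * h
  · simp
    field_simp
    linear_combination e 0 * h

/-- A line meeting the interior of a convex set meets the set within the chord spanned by two
boundary points. -/
theorem mem_Icc_of_mem_line {E : Type*} [NormedAddCommGroup E] [NormedSpace ℝ E] {C : Set E}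
    (hconv : Convex ℝ C) {s e : E} {μ : ℝ} (hμ : μ ∈ Ioo (0 : ℝ) 1)
    (hint : s + μ • e ∈ interior C) (hs : s ∉ interior C) (ht : s + e ∉ interior C) {a : ℝ}
    (ha : s + a • e ∈ C) : a ∈ Icc (0 : ℝ) 1 := by
  have key : ∀ c ∈ Ioo (0 : ℝ) 1, s + ((1 - c) * μ + c * a) • e ∈ interior C := by
    intro c hc
    refine hconv.openSegment_interior_self_subset_interior hint ha
      ⟨1 - c, c, by linarith [hc.2], hc.1, by ring, ?_⟩
    module
  constructor
  · by_contra! h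
    have h1 : 0 < μ - a := by linarith [hμ.1]
    apply hs
    convert key (μ / (μ - a)) ⟨div_pos hμ.1 h1, (div_lt_one h1).2 (by linarith)⟩ using 1
    rw [show (1 - μ / (μ - a)) * μ + μ / (μ - a) * a = 0 by field_simp; ring]
    simp
  · by_contra! h
    have h1 : 0 < a - μ := by linarith [hμ.2]
    apply ht
    convert key ((1 - μ) / (a - μ)) ⟨div_pos (by linarith [hμ.2]) h1,
      (div_lt_one h1).2 (by linarith)⟩ using 1
    rw [show (1 - (1 - μ) / (a - μ)) * μ + (1 - μ) / (a - μ) * a = 1 by field_simp; ring]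
    simp

/-- Seen from two points `p` and `q` of a convex set across the chord from `s` to `t`, a point `y`
of the set lies in the triangle cut off by the lines `ps` and `qt`. -/
theorem exists_chord_coords {C : Set Plane} (hconv : Convex ℝ C) {s t p n : Plane} {α μ : ℝ}
    (hα : 0 < α) (hμ : μ ∈ Ioo (0 : ℝ) 1) (hint : s + μ • (t - s) ∈ interior C)
    (hs : s ∉ interior C) (ht : t ∉ interior C)
    (hline : ∀ x : Plane, ⟪x - s, n⟫ = 0 → ∃ a : ℝ, x = s + a • (t - s))
    (hp : p ∈ C) (hq : p + α⁻¹ • (t - s) ∈ C) (hpn : ⟪p - s, n⟫ < 0) {y : Plane} (hy : y ∈ C)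
    (hyn : 0 ≤ ⟪y - s, n⟫) :
    ∃ a θ : ℝ, 0 ≤ a ∧ 0 ≤ θ ∧ α * a + θ ≤ α ∧
      (1 - θ) • (y - s) = a • (t - s) - θ • (p - s) := by
  have ht' : s + (t - s) ∉ interior C := by simpa using ht
  set k := -⟪p - s, n⟫ with hk
  set h := ⟪y - s, n⟫ with hh
  have hkpos : 0 < k := by linarith
  have hsum : 0 < h + k := by linarith
  set θ := h / (h + k) with hθ
  have hθ0 : 0 ≤ θ := div_nonneg hyn hsum.le
  have hθ1 : θ ≤ 1 := (div_le_one hsum).2 (by linarith)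
  have hxC : (1 - θ) • y + θ • p ∈ C := hconv hy hp (by linarith) hθ0 (by ring)
  have hxq : (1 - θ) • y + θ • (p + α⁻¹ • (t - s)) ∈ C :=
    hconv hy hq (by linarith) hθ0 (by ring)
  obtain ⟨a, ha⟩ := hline ((1 - θ) • y + θ • p) (by
    rw [show (1 - θ) • y + θ • p - s = (1 - θ) • (y - s) + θ • (p - s) by module,
      inner_add_left, real_inner_smul_left, real_inner_smul_left, ← hh,
      show ⟪p - s, n⟫ = -k by rw [hk, neg_neg], hθ]
    field_simp
    ring)
  have h1 := mem_Icc_of_mem_line hconv hμ hint hs ht' (a := a) (ha ▸ hxC)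
  have h2 := mem_Icc_of_mem_line hconv hμ hint hs ht' (a := a + θ * α⁻¹) (by
    convert hxq using 1
    rw [smul_add, ← add_assoc, ha]
    module)
  refine ⟨a, θ, h1.1, hθ0, ?_, ?_⟩
  · have := mul_le_mul_of_nonneg_left h2.2 hα.le
    rwa [mul_add, mul_one, mul_comm θ, mul_inv_cancel_left₀ hα.ne'] at this
  · have : a • (t - s) = (1 - θ) • y + θ • p - s := by rw [ha]; module
    rw [this]
    module

theorem two_mul_inner_sub_le {C : Set Plane} (hC : IsCompact C) (hconv : Convex ℝ C)
    {s t p n : Plane} {α μ : ℝ}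
    (hα : 0 < α) (hα1 : α < 1) (hμ : μ ∈ Ioo (0 : ℝ) 1) (hint : s + μ • (t - s) ∈ interior C)
    (hs : s ∉ interior C) (ht : t ∉ interior C)
    (hline : ∀ x : Plane, ⟪x - s, n⟫ = 0 → ∃ a : ℝ, x = s + a • (t - s))
    (hp : p ∈ C) (hq : p + α⁻¹ • (t - s) ∈ C) (hpn : ⟪p - s, n⟫ < 0) {y y' : Plane} (hy : y ∈ C)
    (hyn : 0 ≤ ⟪y - s, n⟫) (hy' : y' ∈ C) (hyn' : 0 ≤ ⟪y' - s, n⟫) (u : Plane) :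
    2 * ⟪y - y', u⟫ - |⟪t - s, u⟫| ≤ 2 * α * extent C u := by
  obtain ⟨a, θ, ha, hθ, h, e⟩ := exists_chord_coords hconv hα hμ hint hs ht hline hp hq hpn
    hy hyn
  obtain ⟨a', θ', ha', hθ', h', e'⟩ := exists_chord_coords hconv hα hμ hint hs ht hline hp hq
    hpn hy' hyn'
  have E := congrArg (fun x => ⟪x, u⟫) e
  have E' := congrArg (fun x => ⟪x, u⟫) e'
  simp only [inner_sub_left, real_inner_smul_left] at E E'
  have r1 := inner_sub_le_extent hC u hy hp
  have r2 := inner_sub_le_extent hC u hy hq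
  have r3 := inner_sub_le_extent hC u hq hy'
  have r4 := inner_sub_le_extent hC u hq hp
  have r1' := inner_sub_le_extent hC u hp hy'
  have r4' := inner_sub_le_extent hC u hp hq
  simp only [inner_sub_left, inner_add_left, real_inner_smul_left] at *
  rcases le_total 0 (⟪t, u⟫ - ⟪s, u⟫) with hδ | hδ
  · rw [abs_of_nonneg hδ]
    have := two_mul_sub_le_of_chords (P := ⟪p, u⟫ - ⟪s, u⟫) (Y := ⟪y, u⟫ - ⟪s, u⟫)
      (Y' := ⟪y', u⟫ - ⟪s, u⟫) (R := extent C u) hα hα1 hδ hθ hθ' ha ha' h h' E E'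
      (by linarith) (by rw [div_eq_inv_mul]; linarith) (by rw [div_eq_inv_mul]; linarith)
      (by rw [div_eq_inv_mul]; linarith)
    linarith
  · rw [abs_of_nonpos hδ]
    have := two_mul_sub_le_of_chords (P := -(⟪p, u⟫ - ⟪s, u⟫)) (Y := -(⟪y', u⟫ - ⟪s, u⟫))
      (Y' := -(⟪y, u⟫ - ⟪s, u⟫)) (R := extent C u) hα hα1 (neg_nonneg.2 hδ) hθ' hθ ha' ha h' h
      (by linarith) (by linarith)
      (by linarith) (by rw [div_eq_inv_mul]; linarith) (by rw [div_eq_inv_mul]; linarith)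
      (by rw [div_eq_inv_mul]; linarith)
    linarith

theorem exists_frontier_path {C : Set Plane} (hC : IsCompact C) (hconv : Convex ℝ C)
    {s t n : Plane} {μ : ℝ} (hint : s + μ • (t - s) ∈ interior C)
    (hs : s ∈ frontier C) (ht : t ∈ frontier C) (hn : ⟪t - s, n⟫ = 0) (hn0 : n ≠ 0) :
    ∃ γ : ℝ → Plane, ContinuousOn γ (Icc 0 1) ∧ γ 0 = s ∧ γ 1 = t ∧
      MapsTo γ (Icc 0 1) (frontier C) ∧ (∀ τ ∈ Icc (0 : ℝ) 1, 0 ≤ ⟪γ τ - s, n⟫) ∧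
      ∀ u : Plane, ∃ i ∈ Icc (0 : ℝ) 1, ∃ j ∈ Icc (0 : ℝ) 1,
        eVariationOn (fun τ => ⟪γ τ, u⟫) (Icc 0 1) ≤
          ENNReal.ofReal (2 * ⟪γ j - γ i, u⟫ - |⟪t - s, u⟫|) := by
  obtain ⟨o, ho, hon⟩ : ∃ o ∈ interior C, ⟪o - s, n⟫ < 0 := by
    have hpath : Filter.Tendsto (fun ε : ℝ => s + μ • (t - s) - ε • n) (nhdsWithin 0 (Ioi 0))
        (nhds (s + μ • (t - s))) := by
      have : Continuous (fun ε : ℝ => s + μ • (t - s) - ε • n) := by fun_prop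
      simpa using (this.tendsto 0).mono_left nhdsWithin_le_nhds
    obtain ⟨ε, hε, hε0⟩ := ((hpath.eventually (isOpen_interior.mem_nhds hint)).and
      self_mem_nhdsWithin).exists
    refine ⟨_, hε, ?_⟩
    rw [show s + μ • (t - s) - ε • n - s = μ • (t - s) - ε • n by abel, inner_sub_left,
      real_inner_smul_left, real_inner_smul_left, hn, real_inner_self_eq_norm_sq]
    have : 0 < ‖n‖ := norm_pos_iff.2 hn0
    have : 0 < ε := hε0
    simp only [mul_zero, zero_sub, neg_lt_zero]
    positivity
  have hsn : 0 < ⟪s - o, n⟫ := by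
    rw [← neg_sub, inner_neg_left]
    linarith
  have htn : ⟪t - o, n⟫ = ⟪s - o, n⟫ := by
    rw [← sub_eq_zero, ← inner_sub_left, ← hn]
    congr 1
    abel
  have hvn : ∀ a : ℝ, ⟪(1 - a) • (s - o) + a • (t - o), n⟫ = ⟪s - o, n⟫ := by
    intro a
    rw [inner_add_left, real_inner_smul_left, real_inner_smul_left, htn]
    ring
  let Φ : Plane ≃ₜ Plane := Homeomorph.addLeft o
  have hfr : frontier (Φ ⁻¹' C) = Φ ⁻¹' frontier C := (Φ.preimage_frontier C).symm
  have hK : IsCompact (Φ ⁻¹' C) := Φ.isCompact_preimage.2 hC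
  obtain ⟨γ, hc, h0, h1, hm, hr, hrad⟩ := exists_radial_path (K := Φ ⁻¹' C) (S := s - o)
    (T := t - o) hK.isBounded (hconv.translate_preimage_right o) hK.isClosed
    (Φ.continuous.continuousAt.preimage_mem_nhds (by simpa [Φ] using mem_interior_iff_mem_nhds.1 ho))
    (by rw [hfr]; simpa [Φ] using hs) (by rw [hfr]; simpa [Φ] using ht)
    (fun a _ h => by
      have := hvn a
      rw [h, inner_zero_left] at this
      exact hsn.ne this)
  have hc' : ContinuousOn (fun τ => o + γ τ) (Icc 0 1) := continuousOn_const.add hc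
  refine ⟨fun τ => o + γ τ, hc', by simp [h0], by simp [h1], ?_, ?_, ?_⟩
  · intro τ hτ
    have := hm hτ
    rwa [hfr] at this
  · intro τ hτ
    obtain ⟨r, hr1, hr2⟩ := hr τ hτ
    simp only
    rw [show o + γ τ - s = γ τ - (s - o) by abel, inner_sub_left, hr2, real_inner_smul_left, hvn]
    nlinarith
  · intro u
    have hcross := crossing_of_radial (f := fun τ => ⟪o + γ τ, u⟫) (g₀ := ⟪o, u⟫) (by
      intro i j k hi hij hjk hk
      obtain ⟨α, β, hα, hβ, hαβ, e⟩ := hrad i j k hi hij hjk hk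
      refine ⟨α, β, hα, hβ, hαβ, ?_⟩
      simp only [inner_add_left, e, real_inner_smul_left]
      ring)
    obtain ⟨i, hi, j, hj, h⟩ :=
      eVariationOn_le_of_crossing (hc'.inner continuousOn_const) hcross
    refine ⟨i, hi, j, hj, h.trans (le_of_eq ?_)⟩
    simp only [h0, h1, inner_sub_left, inner_add_left]
    congr 3
    ring

theorem exists_path_projections_le {C : Set Plane} (hC : IsCompact C) (hconv : Convex ℝ C)
    (hw : 0 < setWidth C) {s t : Plane} (hs : s ∈ frontier C) (ht : t ∈ frontier C)
    (hst : s ≠ t) {μ : ℝ} (hμ : μ ∈ Ioo (0 : ℝ) 1) (hint : s + μ • (t - s) ∈ interior C) :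
    ∃ γ : ℝ → Plane, ContinuousOn γ (Icc 0 1) ∧ γ 0 = s ∧ γ 1 = t ∧
      MapsTo γ (Icc 0 1) (frontier C) ∧ ∀ u : Plane,
        eVariationOn (fun τ => ⟪γ τ, u⟫) (Icc 0 1) ≤
          ENNReal.ofReal (2 * (dist s t / setWidth C) * extent C u) := by
  have hfC := hC.isClosed.frontier_subset
  have hne : C.Nonempty := ⟨s, hfC hs⟩
  have hd : 0 < dist s t := dist_pos.2 hst
  have he : t - s ≠ 0 := sub_ne_zero.2 hst.symm
  have hnorm : ‖t - s‖ = dist s t := by rw [dist_comm, dist_eq_norm]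
  set w := setWidth C
  have hn0 : rightRot (t - s) ≠ 0 := by
    rw [← norm_pos_iff, norm_rightRot]
    exact norm_pos_iff.2 he
  have hline : ∀ x : Plane, ⟪x - s, rightRot (t - s)⟫ = 0 → ∃ a : ℝ, x = s + a • (t - s) := by
    intro x hx
    obtain ⟨a, ha⟩ := exists_smul_of_inner_rightRot_eq_zero he hx
    exact ⟨a, by rw [← ha]; abel⟩
  rcases le_or_gt w (dist s t) with hlt | hlt
  · obtain ⟨γ, hc, h0, h1, hm, -, hv⟩ := exists_frontier_path hC hconv hint hs ht
      (inner_rightRot_self _) hn0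
    refine ⟨γ, hc, h0, h1, hm, fun u => ?_⟩
    obtain ⟨i, hi, j, hj, h⟩ := hv u
    refine h.trans (ENNReal.ofReal_le_ofReal ?_)
    have h1 := inner_sub_le_extent hC u (hfC (hm hj)) (hfC (hm hi))
    have h2 : 1 ≤ dist s t / w := (one_le_div hw).2 hlt
    nlinarith [abs_nonneg ⟪t - s, u⟫, extent_nonneg hC hne u]
  · have hα : 0 < dist s t / w := div_pos hd hw
    have hα1 : dist s t / w < 1 := (div_lt_one hw).2 hlt
    have hs' : s ∉ interior C := hs.2
    have ht' : t ∉ interior C := ht.2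
    obtain ⟨p, hp, hq⟩ := exists_chord hC hconv hne hw.le (v := (dist s t)⁻¹ • (t - s))
      (by rw [norm_smul, norm_inv, hnorm, Real.norm_of_nonneg hd.le, inv_mul_cancel₀ hd.ne'])
    rw [smul_smul, ← div_eq_mul_inv, ← inv_div] at hq
    have hpn : ⟪p - s, rightRot (t - s)⟫ ≠ 0 := by
      intro h
      obtain ⟨a, rfl⟩ := hline p h
      have ht'' : s + (t - s) ∉ interior C := by simpa using ht'
      have h1 := mem_Icc_of_mem_line hconv hμ hint hs' ht'' hp
      rw [add_assoc, ← add_smul] at hq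
      have h2 := mem_Icc_of_mem_line hconv hμ hint hs' ht'' hq
      have := (one_lt_inv₀ hα).2 hα1
      linarith [h1.1, h2.2]
    obtain ⟨n, hn, hn0, hline, hpn⟩ : ∃ n : Plane, ⟪t - s, n⟫ = 0 ∧ n ≠ 0 ∧
        (∀ x : Plane, ⟪x - s, n⟫ = 0 → ∃ a : ℝ, x = s + a • (t - s)) ∧ ⟪p - s, n⟫ < 0 := by
      rcases hpn.lt_or_gt with h | h
      · exact ⟨_, inner_rightRot_self _, hn0, hline, h⟩
      · refine ⟨-rightRot (t - s), ?_, neg_ne_zero.2 hn0, fun x hx => hline x ?_, ?_⟩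
        · rw [inner_neg_right, inner_rightRot_self, neg_zero]
        · rwa [inner_neg_right, neg_eq_zero] at hx
        · rw [inner_neg_right]
          linarith
    obtain ⟨γ, hc, h0, h1, hm, hpos, hv⟩ := exists_frontier_path hC hconv hint hs ht hn hn0
    refine ⟨γ, hc, h0, h1, hm, fun u => ?_⟩
    obtain ⟨i, hi, j, hj, h⟩ := hv u
    exact h.trans (ENNReal.ofReal_le_ofReal
      (two_mul_inner_sub_le hC hconv hα hα1 hμ hint hs' ht' hline hp hq hpn
        (hfC (hm hj)) (hpos j hj) (hfC (hm hi)) (hpos i hi) u))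

/-- Let `λ ∈ (0,1]` and let `C` be a `λ`-fat compact convex set with nonempty
interior (i.e. `width C ≥ λ·diam₂ C`). Then any two distinct boundary points `s, t` are joined
by a continuous path along `frontier C` of length at most
`min{π/λ, 2·(1/λ + 1)}·dist s t`. -/
theorem fat_convex_dilation
    (lam : ℝ) (hlam : lam ∈ Set.Ioc (0 : ℝ) 1)
    (C : Set Plane) (hC : IsCompact C) (hconv : Convex ℝ C)
    (hint : (interior C).Nonempty)
    (hfat : lam * Metric.diam C ≤ setWidth C) :
    ∀ s ∈ frontier C, ∀ t ∈ frontier C, s ≠ t →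
      ∃ γ : ℝ → Plane,
        ContinuousOn γ (Set.Icc 0 1) ∧ γ 0 = s ∧ γ 1 = t ∧
        Set.MapsTo γ (Set.Icc 0 1) (frontier C) ∧
        pathLen γ ≤
          ENNReal.ofReal (min (Real.pi / lam) (2 * (1 / lam + 1)) * dist s t) := by
  intro s hs t ht hst
  obtain ⟨hl0, hl1⟩ := hlam
  have hfC := hC.isClosed.frontier_subset
  have hd : 0 < dist s t := dist_pos.2 hst
  have hD : 0 < Metric.diam C :=
    hd.trans_le (Metric.dist_le_diam_of_mem hC.isBounded (hfC hs) (hfC ht))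
  have hw : 0 < setWidth C := (mul_pos hl0 hD).trans_le hfat
  have hne : C.Nonempty := ⟨s, hfC hs⟩
  by_cases hseg : ∃ μ ∈ Ioo (0 : ℝ) 1, s + μ • (t - s) ∈ interior C
  · obtain ⟨μ, hμ, hμC⟩ := hseg
    obtain ⟨γ, hc, h0, h1, hm, hproj⟩ := exists_path_projections_le hC hconv hw hs ht hst hμ hμC
    refine ⟨γ, hc, h0, h1, hm, ?_⟩
    have hα : 0 < dist s t / setWidth C := div_pos hd hw
    have hratio : Metric.diam C / setWidth C ≤ 1 / lam := by
      rw [div_le_div_iff₀ hw hl0]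
      linarith
    rw [min_mul_of_nonneg _ _ hd.le, ENNReal.ofReal_min, le_min_iff]
    constructor
    · refine (eVariationOn_le_pi_of_projections (B := dist s t / setWidth C * Metric.diam C)
        (by positivity) fun u hu => (hproj u).trans (ENNReal.ofReal_le_ofReal ?_)).trans
        (ENNReal.ofReal_le_ofReal ?_)
      · rw [mul_assoc]
        have := extent_le_diam hC hne hu
        gcongr
      · calc Real.pi * (dist s t / setWidth C * Metric.diam C)
            = Real.pi * (Metric.diam C / setWidth C) * dist s t := by ring
          _ ≤ Real.pi * (1 / lam) * dist s t := by gcongr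
          _ = Real.pi / lam * dist s t := by ring
    · have hbound : ∀ ε : ℝ, 0 < ε → pathLen γ ≤ ENNReal.ofReal
          (2 * (1 / lam + 1) * dist s t + 2 * (dist s t / setWidth C) * ε) := by
        intro ε hε
        obtain ⟨u, hu, hlt⟩ := exists_extent_lt C hε
        have hn1 := extent_nonneg hC hne u
        have hn2 := extent_nonneg hC hne (rightRot u)
        refine (eVariationOn_le_add_of_projections hu (by positivity) (by positivity) (hproj u)
          (hproj (rightRot u))).trans (ENNReal.ofReal_le_ofReal ?_)
        have := extent_le_diam hC hne ((norm_rightRot u).trans hu)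
        calc 2 * (dist s t / setWidth C) * extent C u
              + 2 * (dist s t / setWidth C) * extent C (rightRot u)
            ≤ 2 * (dist s t / setWidth C) * (setWidth C + ε)
              + 2 * (dist s t / setWidth C) * Metric.diam C := by gcongr
          _ = 2 * (Metric.diam C / setWidth C + 1) * dist s t
              + 2 * (dist s t / setWidth C) * ε := by field_simp; ring
          _ ≤ _ := by gcongr
      have hlim : Filter.Tendsto (fun ε : ℝ => ENNReal.ofReal
          (2 * (1 / lam + 1) * dist s t + 2 * (dist s t / setWidth C) * ε))
          (nhdsWithin 0 (Ioi 0)) (nhds (ENNReal.ofReal (2 * (1 / lam + 1) * dist s t))) := by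
        have : Continuous fun ε : ℝ => ENNReal.ofReal
            (2 * (1 / lam + 1) * dist s t + 2 * (dist s t / setWidth C) * ε) :=
          ENNReal.continuous_ofReal.comp (by fun_prop)
        simpa using (this.tendsto 0).mono_left nhdsWithin_le_nhds
      exact ge_of_tendsto hlim (Filter.eventually_of_mem self_mem_nhdsWithin hbound)
  · push Not at hseg
    refine ⟨fun τ => s + τ • (t - s), by fun_prop, by simp, by simp, ?_, ?_⟩
    · intro τ hτ
      rcases hτ.1.eq_or_lt with rfl | h0
      · simpa using hs
      rcases hτ.2.eq_or_lt with rfl | h1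
      · simpa using ht
      rw [hC.isClosed.frontier_eq]
      refine ⟨?_, hseg τ ⟨h0, h1⟩⟩
      exact hconv.add_smul_sub_mem (hfC hs) (hfC ht) hτ
    · have hK : 1 ≤ min (Real.pi / lam) (2 * (1 / lam + 1)) := by
        have h1 : 1 ≤ 1 / lam := (one_le_div hl0).2 hl1
        refine le_min ((one_le_div hl0).2 (by linarith [Real.pi_gt_three])) (by linarith)
      refine (eVariationOn_le_of_sum_norm_le (L := dist s t) fun n τ hτ hmem => ?_).trans
        (ENNReal.ofReal_le_ofReal (by nlinarith))
      have hterm : ∀ i, ‖s + τ (i + 1) • (t - s) - (s + τ i • (t - s))‖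
          = (τ (i + 1) - τ i) * dist s t := by
        intro i
        rw [add_sub_add_left_eq_sub, ← sub_smul, norm_smul,
          Real.norm_of_nonneg (sub_nonneg.2 (hτ i.le_succ)), dist_comm, dist_eq_norm]
      simp only [hterm]
      rw [← Finset.sum_mul, Finset.sum_range_sub]
      have h1 := (hmem n).2
      have h2 := (hmem 0).1
      nlinarith
end
end

section
/- There is an absolute constant C > 0 with the following property. Let λ ∈ (0,1], let h be a natural number, and let P = P₀ \ ⋃_{i=1}^h interior(Pᵢ), where P₀ is a convex polygon in ℝ² and P₁, …, P_h are pairwise disjoint λ-fat convex polygons with nonempty interior contained in the interior of P₀. Then for all s, t ∈ P, the geodesic distance satisfies geod_P(s,t) ≤ C·λ⁻¹·dist(s,t). -/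
open Set Metric ENNReal RealInnerProductSpace

noncomputable section

/-- Concatenating paths gives the triangle inequality for geodesic distance. -/
theorem geod_triangle (P : Set Plane) (s r t : Plane) :
    geod P s t ≤ geod P s r + geod P r t := by
  refine ENNReal.le_iInf_add_iInf ?_
  rintro ⟨γ₁, hc₁, h₁s, h₁r, hm₁⟩ ⟨γ₂, hc₂, h₂r, h₂t, hm₂⟩
  have mA : MapsTo (fun τ : ℝ => 2 * τ) (Icc 0 (1 / 2)) (Icc 0 1) := fun τ hτ =>
    ⟨by linarith [hτ.1], by linarith [hτ.2]⟩
  have mB : MapsTo (fun τ : ℝ => 2 * τ - 1) (Icc (1 / 2) 1) (Icc 0 1) := fun τ hτ =>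
    ⟨by linarith [hτ.1], by linarith [hτ.2]⟩
  set γ : ℝ → Plane := fun τ => if τ ≤ 1 / 2 then γ₁ (2 * τ) else γ₂ (2 * τ - 1) with hγ
  have eA : EqOn γ (γ₁ ∘ fun τ => 2 * τ) (Icc 0 (1 / 2)) := fun τ hτ => if_pos hτ.2
  have eB : EqOn γ (γ₂ ∘ fun τ => 2 * τ - 1) (Icc (1 / 2) 1) := fun τ hτ => by
    rcases hτ.1.eq_or_lt with h | h
    · subst h
      simp [hγ, h₁r, h₂r]
    · exact if_neg (not_le.2 h)
  have hU : Icc (0 : ℝ) 1 = Icc 0 (1 / 2) ∪ Icc (1 / 2) 1 :=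
    (Icc_union_Icc_eq_Icc (by norm_num) (by norm_num)).symm
  have hγP : IsPathIn P γ s t := by
    refine ⟨?_, by simp [hγ, h₁s], ?_, ?_⟩
    · rw [hU]
      refine ContinuousOn.union_of_isClosed ?_ ?_ isClosed_Icc isClosed_Icc
      · exact (hc₁.comp (by fun_prop) mA).congr eA
      · exact (hc₂.comp (by fun_prop) mB).congr eB
    · have : ¬ (1 : ℝ) ≤ 1 / 2 := by norm_num
      simp only [hγ, if_neg this]
      norm_num [h₂t]
    · rw [hU]
      rintro τ (hτ | hτ)
      · rw [eA hτ]
        exact hm₁ (mA hτ)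
      · rw [eB hτ]
        exact hm₂ (mB hτ)
  refine (iInf_le _ ⟨γ, hγP⟩).trans ?_
  have hsplit := eVariationOn.Icc_add_Icc γ (s := univ) (a := 0) (b := 1 / 2) (c := 1)
    (by norm_num) (by norm_num) (mem_univ _)
  simp only [univ_inter] at hsplit
  simp only [pathLen]
  rw [← hsplit, eVariationOn.congr eA, eVariationOn.congr eB]
  gcongr
  · exact eVariationOn.comp_le_of_monotoneOn _ _ (fun x _ y _ h => by linarith) mA
  · exact eVariationOn.comp_le_of_monotoneOn _ _ (fun x _ y _ h => by linarith) mB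

theorem geod_le_dist_of_segment_subset {P : Set Plane} {s t : Plane} (h : segment ℝ s t ⊆ P) :
    geod P s t ≤ ENNReal.ofReal (dist s t) := by
  have hlip : LipschitzWith (nndist s t) (AffineMap.lineMap s t : ℝ → Plane) :=
    lipschitzWith_lineMap s t
  have hm : MapsTo (AffineMap.lineMap s t : ℝ → Plane) (Icc 0 1) P := by
    intro τ hτ
    apply h
    rw [segment_eq_image_lineMap]
    exact mem_image_of_mem _ hτ
  refine (iInf_le _ ⟨AffineMap.lineMap s t, hlip.continuous.continuousOn, by simp, by simp,
    hm⟩).trans ?_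
  have h1 := (hlip.lipschitzOnWith (s := univ)).comp_eVariationOn_le (g := (id : ℝ → ℝ))
    (s := Icc 0 1) (mapsTo_univ _ _)
  have h2 : eVariationOn (id : ℝ → ℝ) (Icc 0 1) ≤ 1 := by
    simpa only [univ_inter, id, sub_zero, ENNReal.ofReal_one] using
      ((monotone_id.monotoneOn univ).eVariationOn_eq (mem_univ (0 : ℝ)) (mem_univ (1 : ℝ))).le
  simp only [pathLen]
  calc _ ≤ _ := h1
    _ ≤ (nndist s t : ℝ≥0∞) * 1 := by gcongr
    _ = _ := by rw [mul_one, ← edist_nndist, edist_dist]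

theorem geod_mono {P P' : Set Plane} (h : P ⊆ P') (s t : Plane) : geod P' s t ≤ geod P s t :=
  le_iInf fun γ => iInf_le_of_le
    ⟨γ.1, γ.2.1, γ.2.2.1, γ.2.2.2.1, fun _ hx => h (γ.2.2.2.2 hx)⟩ le_rfl

/-- A nonexpansive map does not increase geodesic distances. -/
theorem geod_map_le {P P' : Set Plane} {f : Plane → Plane} (hf : LipschitzWith 1 f)
    (hm : MapsTo f P P') (s t : Plane) : geod P' (f s) (f t) ≤ geod P s t := by
  refine le_iInf fun γ => ?_
  obtain ⟨γ, hc, hs, ht, hγ⟩ := γ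
  refine (iInf_le _ ⟨f ∘ γ, hf.continuous.comp_continuousOn hc, by simp [hs], by simp [ht],
    hm.comp hγ⟩).trans ?_
  simpa [pathLen] using (hf.lipschitzOnWith (s := univ)).comp_eVariationOn_le (g := γ)
    (s := Icc 0 1) (mapsTo_univ _ _)

/-- The nearest-point projection onto a compact convex set is nonexpansive, fixes the set, and
sends points outside the interior to points outside the interior. -/
theorem exists_convex_projection {Q : Set Plane} (hne : Q.Nonempty) (hK : IsCompact Q)
    (hQ : Convex ℝ Q) :
    ∃ f : Plane → Plane, LipschitzWith 1 f ∧ (∀ x ∈ Q, f x = x) ∧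
      MapsTo f (interior Q)ᶜ (Q \ interior Q) := by
  have hex : ∀ x : Plane, ∃ y ∈ Q, ∀ w ∈ Q, inner ℝ (x - y) (w - y) ≤ 0 := by
    intro x
    obtain ⟨y, hy, h⟩ := exists_norm_eq_iInf_of_complete_convex hne hK.isComplete hQ x
    exact ⟨y, hy, (norm_eq_iInf_iff_real_inner_le_zero hQ hy).1 h⟩
  choose f hfQ hf using hex
  have hfix : ∀ x ∈ Q, f x = x := by
    intro x hx
    have := hf x x hx
    rw [real_inner_self_eq_norm_sq] at this
    have h0 : ‖x - f x‖ = 0 := by nlinarith [norm_nonneg (x - f x)]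
    exact (sub_eq_zero.1 (norm_eq_zero.1 h0)).symm
  refine ⟨f, ?_, hfix, ?_⟩
  · refine LipschitzWith.of_dist_le_mul fun x y => ?_
    simp only [NNReal.coe_one, one_mul, dist_eq_norm]
    have h1 := hf x (f y) (hfQ y)
    have h2 := hf y (f x) (hfQ x)
    have h3 : ‖f x - f y‖ ^ 2 ≤ inner ℝ (x - y) (f x - f y) := by
      rw [← real_inner_self_eq_norm_sq]
      simp only [inner_sub_left, inner_sub_right] at *
      linarith
    have h4 := real_inner_le_norm (x - y) (f x - f y)
    by_contra! h
    nlinarith [norm_nonneg (x - y), norm_nonneg (f x - f y)]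
  · intro x hx
    refine ⟨hfQ x, fun hinterior => ?_⟩
    by_cases hxQ : x ∈ Q
    · rw [hfix x hxQ] at hinterior
      exact hx hinterior
    · have hcont : Filter.Tendsto (fun ε : ℝ => f x + ε • (x - f x)) (nhdsWithin 0 (Ioi 0))
          (nhds (f x)) := by
        have : Continuous fun ε : ℝ => f x + ε • (x - f x) := by fun_prop
        simpa using (this.tendsto 0).mono_left nhdsWithin_le_nhds
      have hev := hcont.eventually (mem_interior_iff_mem_nhds.1 hinterior)
      obtain ⟨ε, hεQ, hε⟩ := (hev.and self_mem_nhdsWithin).exists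
      have := hf x _ hεQ
      rw [add_sub_cancel_left, inner_smul_right, real_inner_self_eq_norm_sq] at this
      have hε' : 0 < ε := hε
      have h0 : ‖x - f x‖ = 0 := by
        by_contra h0
        have : 0 < ‖x - f x‖ := lt_of_le_of_ne (norm_nonneg _) (Ne.symm h0)
        have : 0 < ε * ‖x - f x‖ ^ 2 := by positivity
        linarith
      apply hxQ
      rw [sub_eq_zero.1 (norm_eq_zero.1 h0)]
      exact hfQ x

/-- A boundary point of a convex body has a supporting half-plane with unit normal. -/
theorem exists_unit_support {Q : Set Plane} (hQ : Convex ℝ Q) (hinterior : (interior Q).Nonempty)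
    {a : Plane} (ha : a ∉ interior Q) :
    ∃ u : Plane, ‖u‖ = 1 ∧ (∀ x ∈ interior Q, inner ℝ u x < inner ℝ u a) ∧
      ∀ x ∈ Q, inner ℝ u x ≤ inner ℝ u a := by
  obtain ⟨f, hf⟩ := geometric_hahn_banach_open_point hQ.interior isOpen_interior ha
  set v := (InnerProductSpace.toDual ℝ Plane).symm f with hv
  have hfv : ∀ x, f x = inner ℝ v x := fun x => InnerProductSpace.toDual_symm_apply.symm
  have hv0 : v ≠ 0 := by
    intro h0
    obtain ⟨x, hx⟩ := hinterior
    have := hf x hx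
    simp [hfv, h0] at this
  have hpos : 0 < ‖v‖⁻¹ := inv_pos.2 (norm_pos_iff.2 hv0)
  have hlt : ∀ x ∈ interior Q, inner ℝ (‖v‖⁻¹ • v) x < inner ℝ (‖v‖⁻¹ • v) a := by
    intro x hx
    have := hf x hx
    rw [hfv, hfv] at this
    rw [real_inner_smul_left, real_inner_smul_left]
    gcongr
  refine ⟨‖v‖⁻¹ • v, by simpa using norm_smul_inv_norm (𝕜 := ℝ) hv0, hlt, fun x hx => ?_⟩
  have hsub : closure (interior Q) ⊆ {y | inner ℝ (‖v‖⁻¹ • v) y ≤ inner ℝ (‖v‖⁻¹ • v) a} :=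
    closure_minimal (fun y hy => (hlt y hy).le) (isClosed_le (by fun_prop) (by fun_prop))
  rw [hQ.closure_interior_eq_closure_of_nonempty_interior hinterior] at hsub
  exact hsub (subset_closure hx)

/-- Two supporting half-planes whose unit normals are not nearly opposite give a short detour
around the body. -/
theorem geod_compl_le_of_supports {I : Set Plane} {a b u v : Plane} {δ : ℝ} (hδ : 0 < δ)
    (hu : ‖u‖ = 1) (hv : ‖v‖ = 1) (hua : ∀ x ∈ I, inner ℝ u x < inner ℝ u a)
    (hvb : ∀ x ∈ I, inner ℝ v x < inner ℝ v b) (huv : δ ≤ ‖u + v‖) :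
    geod Iᶜ a b ≤ ENNReal.ofReal ((4 / δ + 1) * dist a b) := by
  have hn : 0 < ‖u + v‖ := hδ.trans_le huv
  have hsq : ‖u + v‖ ^ 2 = 2 + 2 * inner ℝ u v := by
    rw [norm_add_sq_real, hu, hv]
    ring
  set c : ℝ := 2 * dist a b / ‖u + v‖ ^ 2 with hc
  have hc0 : 0 ≤ c := by positivity
  have hcm : c * ‖u + v‖ ^ 2 = 2 * dist a b := by
    rw [hc]
    field_simp
  set p : Plane := a + c • (u + v) with hp
  have hap : dist a p ≤ 2 / δ * dist a b := by
    rw [hp, dist_self_add_right, norm_smul, Real.norm_of_nonneg hc0, hc]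
    calc 2 * dist a b / ‖u + v‖ ^ 2 * ‖u + v‖ = 2 / ‖u + v‖ * dist a b := by field_simp
      _ ≤ _ := by gcongr
  have hpu : inner ℝ u a ≤ inner ℝ u p := by
    rw [hp, inner_add_right, inner_smul_right, inner_add_right, real_inner_self_eq_norm_sq, hu]
    have : 0 ≤ 1 ^ 2 + inner ℝ u v := by nlinarith
    nlinarith [mul_nonneg hc0 this]
  have hpv : inner ℝ v b ≤ inner ℝ v p := by
    have h1 : inner ℝ v p = inner ℝ v a + dist a b := by
      rw [hp, inner_add_right, inner_smul_right, inner_add_right, real_inner_self_eq_norm_sq, hv,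
        real_inner_comm u v]
      linear_combination hcm / 2 - c / 2 * hsq
    have h2 : inner ℝ v (b - a) ≤ dist a b := by
      have := real_inner_le_norm v (b - a)
      rwa [hv, one_mul, ← dist_eq_norm, dist_comm] at this
    rw [inner_sub_right] at h2
    linarith
  have hseg : ∀ {w q x y : Plane}, (∀ z ∈ I, inner ℝ w z < inner ℝ w q) →
      inner ℝ w q ≤ inner ℝ w x → inner ℝ w q ≤ inner ℝ w y → segment ℝ x y ⊆ Iᶜ := by
    intro w q x y hw hx hy z hz hzI
    have hconv : Convex ℝ {z : Plane | inner ℝ w q ≤ inner ℝ w z} :=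
      convex_halfSpace_ge (innerₛₗ ℝ w).isLinear _
    exact (hw z hzI).not_ge (hconv.segment_subset hx hy hz)
  have hpb : dist p b ≤ 2 / δ * dist a b + dist a b := by
    have := dist_triangle p a b
    rw [dist_comm p a] at this
    linarith
  calc geod Iᶜ a b ≤ geod Iᶜ a p + geod Iᶜ p b := geod_triangle _ _ _ _
    _ ≤ ENNReal.ofReal (dist a p) + ENNReal.ofReal (dist p b) := by
      gcongr
      · exact geod_le_dist_of_segment_subset (hseg hua le_rfl hpu)
      · exact geod_le_dist_of_segment_subset (hseg hvb hpv le_rfl)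
    _ = ENNReal.ofReal (dist a p + dist p b) :=
      (ENNReal.ofReal_add dist_nonneg dist_nonneg).symm
    _ ≤ _ := by
      apply ENNReal.ofReal_le_ofReal
      calc _ ≤ 2 / δ * dist a b + (2 / δ * dist a b + dist a b) := add_le_add hap hpb
        _ = _ := by ring

theorem exists_unit_orthogonal {u : Plane} (hu : ‖u‖ = 1) :
    ∃ w : Plane, ‖w‖ = 1 ∧ inner ℝ u w = 0 := by
  refine ⟨!₂[-u 1, u 0], ?_, ?_⟩
  · rw [EuclideanSpace.norm_eq] at hu ⊢
    rw [← hu]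
    simp [Fin.sum_univ_two, add_comm]
  · simp [PiLp.inner_apply, Fin.sum_univ_two]
    ring

theorem setWidth_le_of_forall {Q : Set Plane} (hne : Q.Nonempty) (hK : IsCompact Q) {u : Plane}
    (hu : ‖u‖ = 1) {m M : ℝ} (hM : ∀ x ∈ Q, inner ℝ u x ≤ M) (hm : ∀ x ∈ Q, m ≤ inner ℝ u x) :
    setWidth Q ≤ M - m := by
  have hbdd : BddBelow (range fun v : {v : Plane // ‖v‖ = 1} =>
      sSup ((fun x => inner ℝ x v.1) '' Q) - sInf ((fun x => inner ℝ x v.1) '' Q)) := by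
    refine ⟨0, ?_⟩
    rintro _ ⟨v, rfl⟩
    have hK' : IsCompact ((fun x => inner ℝ x v.1) '' Q) := hK.image (by fun_prop)
    exact sub_nonneg.2 (Real.sInf_le_sSup _ hK'.bddBelow hK'.bddAbove)
  refine (ciInf_le hbdd ⟨u, hu⟩).trans (sub_le_sub ?_ ?_)
  · refine csSup_le (hne.image _) ?_
    rintro _ ⟨x, hx, rfl⟩
    simpa [real_inner_comm] using hM x hx
  · refine le_csInf (hne.image _) ?_
    rintro _ ⟨x, hx, rfl⟩
    simpa [real_inner_comm] using hm x hx

/-- Any two boundary points of a convex body are joined outside its interior by a path of length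
comparable to the diameter of the body. -/
theorem geod_compl_interior_le_diam {Q : Set Plane} (hK : IsCompact Q) (hQ : Convex ℝ Q)
    (hinterior : (interior Q).Nonempty) {a b : Plane} (ha : a ∈ Q \ interior Q)
    (hb : b ∈ Q \ interior Q) :
    geod (interior Q)ᶜ a b ≤ ENNReal.ofReal (10 * diam Q) := by
  obtain ⟨u, hu, hua, -⟩ := exists_unit_support hQ hinterior ha.2
  obtain ⟨v, hv, hvb, -⟩ := exists_unit_support hQ hinterior hb.2
  obtain ⟨w, hw, huw, hvw⟩ : ∃ w : Plane, ‖w‖ = 1 ∧ inner ℝ u w = 0 ∧ 0 ≤ inner ℝ v w := by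
    obtain ⟨w, hw, huw⟩ := exists_unit_orthogonal hu
    rcases le_total 0 (inner ℝ v w) with h | h
    · exact ⟨w, hw, huw, h⟩
    · exact ⟨-w, by simpa using hw, by simpa using huw, by simpa using h⟩
  obtain ⟨c, hcQ, hc⟩ := hK.exists_isMaxOn ⟨a, ha.1⟩
    (f := fun x => inner ℝ w x) (by fun_prop)
  have hc' : ∀ x ∈ interior Q, inner ℝ w x < inner ℝ w c := by
    intro x hx
    have hcont : Filter.Tendsto (fun ε : ℝ => x + ε • w) (nhdsWithin 0 (Ioi 0)) (nhds x) := by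
      have : Continuous fun ε : ℝ => x + ε • w := by fun_prop
      simpa using (this.tendsto 0).mono_left nhdsWithin_le_nhds
    obtain ⟨ε, hεQ, hε⟩ :=
      ((hcont.eventually (mem_interior_iff_mem_nhds.1 hx)).and self_mem_nhdsWithin).exists
    have h1 : inner ℝ w (x + ε • w) ≤ inner ℝ w c := hc hεQ
    have hε' : 0 < ε := hε
    rw [inner_add_right, inner_smul_right, real_inner_self_eq_norm_sq, hw] at h1
    linarith
  have hnorm : ∀ {y z : Plane}, ‖y‖ = 1 → ‖z‖ = 1 → 0 ≤ inner ℝ y z → 1 ≤ ‖y + z‖ := by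
    intro y z hy hz h
    have := norm_add_sq_real y z
    rw [hy, hz] at this
    nlinarith [norm_nonneg (y + z)]
  have h1 := geod_compl_le_of_supports one_pos hu hw hua hc' (hnorm hu hw huw.ge)
  have h2 := geod_compl_le_of_supports one_pos hw hv hc' hvb
    (hnorm hw hv (by rwa [real_inner_comm]))
  have d1 := dist_le_diam_of_mem hK.isBounded ha.1 hcQ
  have d2 := dist_le_diam_of_mem hK.isBounded hcQ hb.1
  calc _ ≤ _ := geod_triangle _ a c b
    _ ≤ _ := add_le_add h1 h2
    _ = _ := (ENNReal.ofReal_add (by positivity) (by positivity)).symm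
    _ ≤ _ := ENNReal.ofReal_le_ofReal (by linarith)

/-- The boundary of a fat convex body is a quasi-geodesic. -/
theorem geod_boundary_le_of_fat {Q : Set Plane} (hK : IsCompact Q) (hQ : Convex ℝ Q)
    (hinterior : (interior Q).Nonempty) {lam : ℝ} (hlam : lam ∈ Ioc (0 : ℝ) 1)
    (hfat : lam * diam Q ≤ setWidth Q) {a b : Plane} (ha : a ∈ Q \ interior Q)
    (hb : b ∈ Q \ interior Q) :
    geod (Q \ interior Q) a b ≤ ENNReal.ofReal (20 * lam⁻¹ * dist a b) := by
  obtain ⟨f, hf, hfix, hmaps⟩ := exists_convex_projection ⟨a, ha.1⟩ hK hQ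
  have hproj := geod_map_le hf hmaps a b
  rw [hfix a ha.1, hfix b hb.1] at hproj
  refine hproj.trans ?_
  obtain ⟨u, hu, hua, hua'⟩ := exists_unit_support hQ hinterior ha.2
  obtain ⟨v, hv, hvb, hvb'⟩ := exists_unit_support hQ hinterior hb.2
  have hl : 0 < lam := hlam.1
  rcases le_or_gt (lam / 2) ‖u + v‖ with huv | huv
  · refine (geod_compl_le_of_supports (by positivity) hu hv hua hvb huv).trans
      (ENNReal.ofReal_le_ofReal ?_)
    have h1 : 1 ≤ lam⁻¹ := (one_le_inv₀ hl).2 hlam.2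
    have h2 : 4 / (lam / 2) = 8 * lam⁻¹ := by
      field_simp
      norm_num
    rw [h2]
    gcongr
    linarith
  · refine (geod_compl_interior_le_diam hK hQ hinterior ha hb).trans (ENNReal.ofReal_le_ofReal ?_)
    have hD : 0 ≤ diam Q := diam_nonneg
    have hw := setWidth_le_of_forall ⟨a, ha.1⟩ hK hu hua'
      (m := inner ℝ u a - (dist a b + lam / 2 * diam Q)) fun x hx => by
        have h1 := hvb' x hx
        have h2 : inner ℝ u (a - b) ≤ dist a b := by
          have := real_inner_le_norm u (a - b)
          rwa [hu, one_mul, ← dist_eq_norm] at this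
        have h3 : inner ℝ (u + v) (b - x) ≤ lam / 2 * diam Q := by
          refine (real_inner_le_norm _ _).trans ?_
          rw [← dist_eq_norm]
          exact mul_le_mul huv.le (dist_le_diam_of_mem hK.isBounded hb.1 hx) dist_nonneg
            (by positivity)
        simp only [inner_add_left, inner_sub_right] at h1 h2 h3
        linarith
    have h4 : lam * diam Q ≤ 2 * dist a b := by linarith
    calc 10 * diam Q = 10 * lam⁻¹ * (lam * diam Q) := by field_simp
      _ ≤ 10 * lam⁻¹ * (2 * dist a b) := by gcongr
      _ = _ := by ring

/-- A segment meeting a compact set, with endpoints outside its interior, enters and leaves it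
at boundary points. -/
theorem exists_entry_exit {Q : Set Plane} (hK : IsCompact Q) {s t : Plane} (hs : s ∉ interior Q)
    (ht : t ∉ interior Q) (hmeet : (segment ℝ s t ∩ Q).Nonempty) :
    ∃ a ∈ Q \ interior Q, ∃ b ∈ Q \ interior Q, dist s a + dist a b + dist b t = dist s t ∧
      segment ℝ s a ⊆ segment ℝ s t ∧ segment ℝ b t ⊆ segment ℝ s t ∧
      Disjoint (segment ℝ s a) (interior Q) ∧ Disjoint (segment ℝ b t) (interior Q) := by
  set L : ℝ → Plane := ⇑(AffineMap.lineMap s t : ℝ →ᵃ[ℝ] Plane) with hL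
  have hLc : Continuous L := by
    rw [hL]
    exact AffineMap.lineMap_continuous (R := ℝ)
  have hsub : interior Q ⊆ Q := interior_subset
  have hL0 : L 0 = s := by simp [hL]
  have hL1 : L 1 = t := by simp [hL]
  set T : Set ℝ := Icc 0 1 ∩ L ⁻¹' Q with hT
  have hTc : IsCompact T := isCompact_Icc.inter_right (hK.isClosed.preimage hLc)
  have hTn : T.Nonempty := by
    obtain ⟨x, hx, hxQ⟩ := hmeet
    rw [segment_eq_image_lineMap] at hx
    obtain ⟨τ, hτ, rfl⟩ := hx
    exact ⟨τ, hτ, hxQ⟩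
  obtain ⟨α, hα, hαmin⟩ := hTc.exists_isLeast hTn
  obtain ⟨β, hβ, hβmax⟩ := hTc.exists_isGreatest hTn
  have hαβ : α ≤ β := hαmin hβ
  have hopen : IsOpen (L ⁻¹' interior Q) := isOpen_interior.preimage hLc
  have hαi : L α ∉ interior Q := by
    intro h
    rcases hα.1.1.eq_or_lt with h0 | h0
    · rw [← h0, hL0] at h
      exact hs h
    · have hev : ∀ᶠ τ in nhdsWithin α (Iio α), L τ ∈ interior Q ∧ 0 < τ :=
        nhdsWithin_le_nhds (Filter.inter_mem (hopen.mem_nhds h) (lt_mem_nhds h0))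
      obtain ⟨τ, ⟨h1, h2⟩, h3⟩ := (hev.and self_mem_nhdsWithin).exists
      have h3' : τ < α := h3
      exact (hαmin ⟨⟨h2.le, h3'.le.trans hα.1.2⟩, hsub h1⟩).not_gt h3'
  have hβi : L β ∉ interior Q := by
    intro h
    rcases hβ.1.2.eq_or_lt with h0 | h0
    · rw [h0, hL1] at h
      exact ht h
    · have hev : ∀ᶠ τ in nhdsWithin β (Ioi β), L τ ∈ interior Q ∧ τ < 1 :=
        nhdsWithin_le_nhds (Filter.inter_mem (hopen.mem_nhds h) (gt_mem_nhds h0))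
      obtain ⟨τ, ⟨h1, h2⟩, h3⟩ := (hev.and self_mem_nhdsWithin).exists
      have h3' : β < τ := h3
      exact (hβmax ⟨⟨hβ.1.1.trans h3'.le, h2.le⟩, hsub h1⟩).not_gt h3'
  have hseg : ∀ {x y : ℝ}, x ≤ y → segment ℝ (L x) (L y) = L '' Icc x y := by
    intro x y hxy
    rw [← segment_eq_Icc hxy, hL]
    exact (image_segment ℝ (AffineMap.lineMap s t : ℝ →ᵃ[ℝ] Plane) x y).symm
  have hst : segment ℝ s t = L '' Icc 0 1 := by
    rw [← hL0, ← hL1, hseg zero_le_one]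
  have hsa : segment ℝ s (L α) = L '' Icc 0 α := by
    rw [← hL0, hseg hα.1.1]
  have hbt : segment ℝ (L β) t = L '' Icc β 1 := by
    rw [← hL1, hseg hβ.1.2]
  refine ⟨L α, ⟨hα.2, hαi⟩, L β, ⟨hβ.2, hβi⟩, ?_, ?_, ?_, ?_, ?_⟩
  · have hd : ∀ {x y : ℝ}, x ≤ y → dist (L x) (L y) = (y - x) * dist s t := by
      intro x y hxy
      rw [hL, dist_lineMap_lineMap, Real.dist_eq, abs_sub_comm, abs_of_nonneg (by linarith)]
    rw [hd hαβ]
    nth_rewrite 1 [← hL0]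
    nth_rewrite 2 [← hL1]
    rw [hd hα.1.1, hd hβ.1.2]
    ring
  · rw [hsa, hst]
    exact image_mono (Icc_subset_Icc_right hα.1.2)
  · rw [hbt, hst]
    exact image_mono (Icc_subset_Icc_left hβ.1.1)
  · rw [hsa, disjoint_left]
    rintro _ ⟨τ, hτ, rfl⟩ h
    have : α ≤ τ := hαmin ⟨⟨hτ.1, hτ.2.trans hα.1.2⟩, hsub h⟩
    rw [le_antisymm hτ.2 this] at h
    exact hαi h
  · rw [hbt, disjoint_left]
    rintro _ ⟨τ, hτ, rfl⟩ h
    have : τ ≤ β := hβmax ⟨⟨hβ.1.1.trans hτ.1, hτ.2⟩, hsub h⟩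
    rw [le_antisymm this hτ.1] at h
    exact hβi h

/-- If each hole can be bypassed along its boundary with stretch at most `K ≥ 1`, then so can the
whole family of holes. -/
theorem geod_le_of_bypass {ι : Type*} [Finite ι] {P₀ : Set Plane} {Q : ι → Set Plane} {K : ℝ}
    (hK : 1 ≤ K) (hP₀ : Convex ℝ P₀) (hc : ∀ i, IsCompact (Q i))
    (hbd : ∀ i, Q i \ interior (Q i) ⊆ P₀ \ ⋃ j, interior (Q j))
    (hbypass : ∀ i, ∀ a ∈ Q i \ interior (Q i), ∀ b ∈ Q i \ interior (Q i),
      geod (Q i \ interior (Q i)) a b ≤ ENNReal.ofReal (K * dist a b))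
    {s t : Plane} (hs : s ∈ P₀ \ ⋃ i, interior (Q i)) (ht : t ∈ P₀ \ ⋃ i, interior (Q i)) :
    geod (P₀ \ ⋃ i, interior (Q i)) s t ≤ ENNReal.ofReal (K * dist s t) := by
  classical
  have key : ∀ (I : Finset ι) (s t : Plane), s ∈ P₀ \ ⋃ i, interior (Q i) →
      t ∈ P₀ \ ⋃ i, interior (Q i) →
      (∀ i ∉ I, Disjoint (segment ℝ s t) (interior (Q i))) →
      geod (P₀ \ ⋃ i, interior (Q i)) s t ≤ ENNReal.ofReal (K * dist s t) := by
    intro I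
    induction I using Finset.induction_on with
    | empty =>
      intro s t hs ht hI
      have hsub : segment ℝ s t ⊆ P₀ \ ⋃ i, interior (Q i) := by
        intro x hx
        refine ⟨hP₀.segment_subset hs.1 ht.1 hx, ?_⟩
        simp only [mem_iUnion, not_exists]
        exact fun i => disjoint_left.1 (hI i (by simp)) hx
      refine (geod_le_dist_of_segment_subset hsub).trans (ENNReal.ofReal_le_ofReal ?_)
      nlinarith [dist_nonneg (x := s) (y := t)]
    | insert i I _ ih =>
      intro s t hs ht hI
      by_cases hmeet : (segment ℝ s t ∩ Q i).Nonempty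
      · have hsi : s ∉ interior (Q i) := fun h => hs.2 (mem_iUnion_of_mem i h)
        have hti : t ∉ interior (Q i) := fun h => ht.2 (mem_iUnion_of_mem i h)
        obtain ⟨a, ha, b, hb, hd, hsa, hbt, hdsa, hdbt⟩ :=
          exists_entry_exit (hc i) hsi hti hmeet
        have hstep : ∀ {x y : Plane}, segment ℝ x y ⊆ segment ℝ s t →
            Disjoint (segment ℝ x y) (interior (Q i)) →
            ∀ j ∉ I, Disjoint (segment ℝ x y) (interior (Q j)) := by
          intro x y hxy hdis j hj
          by_cases hji : j = i
          · rwa [hji]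
          · exact (hI j (by simp [hji, hj])).mono_left hxy
        have h1 := ih s a hs (hbd i ha) (hstep hsa hdsa)
        have h2 := (geod_mono (hbd i) a b).trans (hbypass i a ha b hb)
        have h3 := ih b t (hbd i hb) ht (hstep hbt hdbt)
        have hK0 : 0 ≤ K := zero_le_one.trans hK
        calc _ ≤ _ := geod_triangle _ s b t
          _ ≤ _ := add_le_add ((geod_triangle _ s a b).trans (add_le_add h1 h2)) h3
          _ = _ := by
            rw [← ENNReal.ofReal_add (by positivity) (by positivity),
              ← ENNReal.ofReal_add (by positivity) (by positivity), ← hd]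
            congr 1
            ring
      · refine ih s t hs ht fun j hj => ?_
        by_cases hji : j = i
        · rw [hji]
          exact (disjoint_iff_inter_eq_empty.2 (not_nonempty_iff_eq_empty.1 hmeet)).mono_right
            interior_subset
        · exact hI j (by simp [hji, hj])
  have := Fintype.ofFinite ι
  exact key Finset.univ s t hs ht fun i hi => absurd (Finset.mem_univ i) hi

theorem IsConvexPolygon.convex {Q : Set Plane} (h : IsConvexPolygon Q) : Convex ℝ Q := by
  obtain ⟨S, -, rfl⟩ := h
  exact convex_convexHull ℝ _

theorem IsConvexPolygon.isCompact {Q : Set Plane} (h : IsConvexPolygon Q) : IsCompact Q := by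
  obtain ⟨S, -, rfl⟩ := h
  exact S.finite_toSet.isCompact_convexHull ℝ

/-- There is an absolute constant `C > 0` such that for every `λ ∈ (0,1]`,
every polygonal domain `P = P₀ \ ⋃ᵢ interior Pᵢ` where the holes are pairwise disjoint `λ`-fat
convex polygons with nonempty interior inside the interior of the convex polygon `P₀`, and all
`s, t ∈ P`, the geodesic distance satisfies `geod_P(s,t) ≤ C·λ⁻¹·dist s t`. -/
theorem fat_holes_geodesic_distance :
    ∃ C : ℝ, 0 < C ∧
      ∀ (lam : ℝ), lam ∈ Set.Ioc (0 : ℝ) 1 →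
        ∀ (h : ℕ) (P₀ : Set Plane) (Q : Fin h → Set Plane),
          IsConvexPolygon P₀ →
          (∀ i, IsConvexPolygon (Q i)) →
          (∀ i, (interior (Q i)).Nonempty) →
          (∀ i, lam * Metric.diam (Q i) ≤ setWidth (Q i)) →
          Pairwise (Function.onFun Disjoint Q) →
          (∀ i, Q i ⊆ interior P₀) →
          ∀ s ∈ (P₀ \ ⋃ i, interior (Q i)), ∀ t ∈ (P₀ \ ⋃ i, interior (Q i)),
            geod (P₀ \ ⋃ i, interior (Q i)) s t ≤
              ENNReal.ofReal (C * lam⁻¹ * dist s t) := by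
  refine ⟨20, by norm_num, ?_⟩
  intro lam hlam h P₀ Q hP₀ hQ hinterior hfat hdisj hsub s hs t ht
  have h1 : 1 ≤ lam⁻¹ := (one_le_inv₀ hlam.1).2 hlam.2
  refine geod_le_of_bypass (by linarith) hP₀.convex (fun i => (hQ i).isCompact) ?_ ?_ hs ht
  · intro i x hx
    refine ⟨interior_subset (hsub i hx.1), ?_⟩
    simp only [mem_iUnion, not_exists]
    intro j hj
    by_cases hij : i = j
    · subst hij
      exact hx.2 hj
    · exact disjoint_left.1 (hdisj hij) hx.1 (interior_subset hj)
  · intro i a ha b hb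
    exact geod_boundary_le_of_fat (hQ i).isCompact (hQ i).convex (hinterior i) hlam (hfat i) ha hb
end
end

section
/- There is an absolute constant C > 0 with the following property. Let λ ∈ (0,1], let h be a natural number, and let P = P₀ \ ⋃_{i=1}^h interior(Pᵢ), where P₀ is a convex polygon in ℝ² and P₁, …, P_h are pairwise disjoint λ-fat convex polygons with nonempty interior contained in the interior of P₀. Then the geodesic diameter satisfies diam_g(P) ≤ C·λ⁻¹·diam₂(P); in particular the distortion ϱ(P) = diam_g(P)/diam₂(P) is O(λ⁻¹), independent of the number of holes h. -/
open Set Metric ENNReal RealInnerProductSpace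

noncomputable section

/-- `s` and `t` are joined inside `P` by a `1`-Lipschitz path parametrized on `[0, L]`. -/
def LipJoined (P : Set Plane) (L : ℝ) (s t : Plane) : Prop :=
  0 ≤ L ∧ ∃ γ : ℝ → Plane, LipschitzWith 1 γ ∧ γ 0 = s ∧ γ L = t ∧ ∀ x, γ x ∈ P

namespace LipJoined

theorem mono {P P' : Set Plane} {L L' : ℝ} {s t : Plane} (h : LipJoined P L s t)
    (hP : P ⊆ P') (hL : L ≤ L') : LipJoined P' L' s t := by
  obtain ⟨h0, γ, hγ, hs, ht, hm⟩ := h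
  refine ⟨h0.trans hL, fun x => γ (min x L), ?_, by simp [h0, hs], by simp [hL, ht],
    fun x => hP (hm _)⟩
  simpa [Function.comp_def] using hγ.comp (LipschitzWith.id.min_const L)

theorem map {P P' : Set Plane} {L : ℝ} {s t : Plane} (h : LipJoined P L s t) {f : Plane → Plane}
    (hf : LipschitzWith 1 f) (hP : MapsTo f P P') : LipJoined P' L (f s) (f t) := by
  obtain ⟨h0, γ, hγ, rfl, rfl, hm⟩ := h
  exact ⟨h0, f ∘ γ, by simpa using hf.comp hγ, rfl, rfl, fun x => hP (hm x)⟩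

theorem trans {P : Set Plane} {L₁ L₂ : ℝ} {s t u : Plane} (h₁ : LipJoined P L₁ s t)
    (h₂ : LipJoined P L₂ t u) : LipJoined P (L₁ + L₂) s u := by
  obtain ⟨h10, γ₁, hγ₁, rfl, rfl, hm₁⟩ := h₁
  obtain ⟨h20, γ₂, hγ₂, h, rfl, hm₂⟩ := h₂
  refine ⟨add_nonneg h10 h20, fun x => if x ≤ L₁ then γ₁ x else γ₂ (x - L₁), ?_, by simp [h10],
    ?_, fun x => ?_⟩
  · have key : ∀ x y : ℝ, x ≤ y → dist (if x ≤ L₁ then γ₁ x else γ₂ (x - L₁))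
        (if y ≤ L₁ then γ₁ y else γ₂ (y - L₁)) ≤ dist x y := by
      intro x y hxy
      split_ifs with hx hy hy
      · simpa using hγ₁.dist_le_mul x y
      · have e₁ := hγ₁.dist_le_mul x L₁
        have e₂ := hγ₂.dist_le_mul 0 (y - L₁)
        rw [h] at e₂
        have e₃ := dist_triangle (γ₁ x) (γ₁ L₁) (γ₂ (y - L₁))
        simp only [NNReal.coe_one, one_mul, Real.dist_eq] at e₁ e₂ ⊢
        rw [abs_of_nonpos (by linarith)] at e₁ e₂ ⊢
        linarith
      · linarith
      · simpa [Real.dist_eq] using hγ₂.dist_le_mul (x - L₁) (y - L₁)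
    refine LipschitzWith.of_dist_le_mul fun x y => ?_
    simp only [NNReal.coe_one, one_mul]
    rcases le_total x y with hxy | hxy
    · exact key x y hxy
    · rw [dist_comm, dist_comm x y]
      exact key y x hxy
  · by_cases h2 : L₂ ≤ 0
    · obtain rfl : L₂ = 0 := le_antisymm h2 h20
      simp [h]
    · simp [h2]
  · dsimp only
    split_ifs
    exacts [hm₁ _, hm₂ _]

theorem of_segment_subset {P : Set Plane} {s t : Plane} (h : segment ℝ s t ⊆ P) :
    LipJoined P (dist s t) s t := by
  have hd : ‖t - s‖ = dist s t := by rw [dist_comm, dist_eq_norm]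
  rcases eq_or_ne s t with rfl | hst
  · exact ⟨dist_nonneg, fun _ => s, LipschitzWith.const' s, rfl, rfl,
      fun _ => h (left_mem_segment ℝ s s)⟩
  have hpos : 0 < dist s t := dist_pos.2 hst
  refine ⟨hpos.le, fun x => s + (max 0 (min x (dist s t))) • (dist s t)⁻¹ • (t - s), ?_,
    by simp, ?_, fun x => h ?_⟩
  · refine LipschitzWith.of_dist_le_mul fun x y => ?_
    have e : LipschitzWith 1 fun x : ℝ => max 0 (min x (dist s t)) :=
      (LipschitzWith.id.min_const (dist s t)).const_max 0
    rw [dist_add_left, dist_eq_norm, ← sub_smul, norm_smul, norm_smul, norm_inv, hd,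
      Real.norm_of_nonneg hpos.le, inv_mul_cancel₀ hpos.ne', mul_one, ← dist_eq_norm]
    exact e.dist_le_mul x y
  · simp [smul_smul, hpos.ne']
  · rw [segment_eq_image']
    refine ⟨max 0 (min x (dist s t)) * (dist s t)⁻¹, ⟨by positivity, ?_⟩, by simp [smul_smul]⟩
    rw [← div_eq_mul_inv, div_le_one hpos]
    simp

theorem geod_le {P : Set Plane} {L : ℝ} {s t : Plane} (h : LipJoined P L s t) :
    geod P s t ≤ ENNReal.ofReal L := by
  obtain ⟨h0, γ, hγ, rfl, rfl, hm⟩ := h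
  have hmono : Monotone fun x : ℝ => L * x := fun x y hxy => mul_le_mul_of_nonneg_left hxy h0
  refine (iInf_le _ (⟨fun x => γ (L * x), ?_, by simp, by simp, fun x _ => hm _⟩ :
    {γ' : ℝ → Plane // IsPathIn P γ' (γ 0) (γ L)})).trans ?_
  · exact (hγ.continuous.comp (continuous_const.mul continuous_id)).continuousOn
  · have e₁ := (hγ.lipschitzOnWith (s := univ)).comp_eVariationOn_le
      (g := fun x : ℝ => L * x) (s := Icc 0 1) (mapsTo_univ _ _)
    have e₂ := (hmono.monotoneOn (Icc (0 : ℝ) 1)).eVariationOn_eq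
      (left_mem_Icc.2 zero_le_one) (right_mem_Icc.2 zero_le_one)
    simp only [Set.inter_self, mul_one, mul_zero, sub_zero, ENNReal.coe_one, one_mul] at e₁ e₂
    exact e₁.trans e₂.le

end LipJoined

/-- A nonzero linear functional is not maximized over a set at an interior point. -/
theorem notMem_interior_of_forall_inner_le {Q : Set Plane} {a n : Plane} (hn : n ≠ 0)
    (h : ∀ x ∈ Q, ⟪x, n⟫ ≤ ⟪a, n⟫) : a ∉ interior Q := by
  intro ha
  have hc : Filter.Tendsto (fun r : ℝ => a + r • n) (nhdsWithin 0 (Ioi 0)) (nhds a) := by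
    have : Continuous fun r : ℝ => a + r • n := by fun_prop
    simpa using (this.tendsto 0).mono_left nhdsWithin_le_nhds
  obtain ⟨r, hr, hr0⟩ := ((hc.eventually (isOpen_interior.mem_nhds ha)).and
    self_mem_nhdsWithin).exists
  have := h _ (interior_subset hr)
  rw [inner_add_left, real_inner_smul_left, real_inner_self_eq_norm_sq] at this
  have : 0 < r * ‖n‖ ^ 2 := mul_pos hr0 (by positivity)
  linarith

/-- `n` is a unit outer normal of `Q` at `a`. -/
structure IsUnitNormalAt (Q : Set Plane) (a n : Plane) : Prop where
  norm_eq : ‖n‖ = 1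
  mem : a ∈ Q
  inner_le : ∀ x ∈ Q, ⟪x, n⟫ ≤ ⟪a, n⟫

theorem IsUnitNormalAt.notMem_interior {Q : Set Plane} {a n x : Plane} (h : IsUnitNormalAt Q a n)
    (hx : ⟪a, n⟫ ≤ ⟪x, n⟫) : x ∉ interior Q :=
  notMem_interior_of_forall_inner_le (norm_ne_zero_iff.1 (by rw [h.norm_eq]; exact one_ne_zero))
    fun y hy => (h.inner_le y hy).trans hx

theorem exists_isUnitNormalAt {Q : Set Plane} (hQ : Convex ℝ Q) (hne : (interior Q).Nonempty)
    {a : Plane} (ha : a ∈ Q) (ha' : a ∉ interior Q) : ∃ n, IsUnitNormalAt Q a n := by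
  obtain ⟨f, hf⟩ := geometric_hahn_banach_open_point hQ.interior isOpen_interior ha'
  set v := (InnerProductSpace.toDual ℝ Plane).symm f with hv
  have hfv : ∀ x, f x = ⟪x, v⟫ := fun x => by
    rw [real_inner_comm, hv, InnerProductSpace.toDual_symm_apply]
  have hv0 : v ≠ 0 := by
    rintro h0
    obtain ⟨y, hy⟩ := hne
    have := hf y hy
    simp [hfv, h0] at this
  have hle : ∀ x ∈ Q, f x ≤ f a := by
    have hcl : closure (interior Q) ⊆ {x | f x ≤ f a} :=
      closure_minimal (fun x hx => (hf x hx).le) (isClosed_le f.continuous continuous_const)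
    rw [hQ.closure_interior_eq_closure_of_nonempty_interior hne] at hcl
    exact fun x hx => hcl (subset_closure hx)
  refine ⟨‖v‖⁻¹ • v, by rw [norm_smul, norm_inv, norm_norm, inv_mul_cancel₀ (by simpa)], ha,
    fun x hx => ?_⟩
  rw [real_inner_smul_right, real_inner_smul_right, ← hfv, ← hfv]
  exact mul_le_mul_of_nonneg_left (hle x hx) (by positivity)

/-- Two boundary points whose unit outer normals are far from opposite are joined outside the
interior by a short path. -/
theorem IsUnitNormalAt.lipJoined_compl {Q : Set Plane} {a b p q : Plane}
    (hp : IsUnitNormalAt Q a p) (hq : IsUnitNormalAt Q b q) {m : ℝ} (hm : 0 < m)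
    (hpq : m ≤ ‖p + q‖) :
    LipJoined (interior Q)ᶜ (dist a b * (1 + 4 / m)) a b := by
  set M := ‖p + q‖ with hM
  have hM0 : 0 < M := hm.trans_le hpq
  have hMsq : M ^ 2 = 2 * (1 + ⟪p, q⟫) := by
    rw [hM, norm_add_sq_real, hp.norm_eq, hq.norm_eq]; ring
  have hup : ⟪p + q, p⟫ = M ^ 2 / 2 := by
    rw [inner_add_left, real_inner_self_eq_norm_sq, hp.norm_eq, real_inner_comm, hMsq]; ring
  have huq : ⟪p + q, q⟫ = M ^ 2 / 2 := by
    rw [inner_add_left, real_inner_self_eq_norm_sq, hq.norm_eq, hMsq]; ring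
  set r := 2 * dist a b / M ^ 2 with hr
  have hr0 : 0 ≤ r := by positivity
  have hrM : r * (M ^ 2 / 2) = dist a b := by rw [hr]; field_simp
  have hap : ⟪a + r • (p + q), p⟫ = ⟪a, p⟫ + dist a b := by
    rw [inner_add_left, real_inner_smul_left, hup, hrM]
  have hbp : ⟪b + r • (p + q), p⟫ = ⟪b, p⟫ + dist a b := by
    rw [inner_add_left, real_inner_smul_left, hup, hrM]
  have hbq : ⟪b + r • (p + q), q⟫ = ⟪b, q⟫ + dist a b := by
    rw [inner_add_left, real_inner_smul_left, huq, hrM]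
  have hab : ⟪a, p⟫ ≤ ⟪b, p⟫ + dist a b := by
    have := real_inner_le_norm (a - b) p
    rw [inner_sub_left, hp.norm_eq, ← dist_eq_norm] at this
    linarith
  have hconv : ∀ c n : Plane, Convex ℝ {x : Plane | ⟪c, n⟫ ≤ ⟪x, n⟫} := fun c n =>
    convex_halfSpace_ge ⟨fun x y => inner_add_left x y n, fun k x => real_inner_smul_left x n k⟩ _
  have hd : (0 : ℝ) ≤ dist a b := dist_nonneg
  have j₁ : LipJoined (interior Q)ᶜ _ a (a + r • (p + q)) :=
    .of_segment_subset fun x hx => hp.notMem_interior ((hconv a p).segment_subset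
      (by simp) (by simpa only [mem_ofPred_eq, hap] using by linarith) hx)
  have j₂ : LipJoined (interior Q)ᶜ _ (a + r • (p + q)) (b + r • (p + q)) :=
    .of_segment_subset fun x hx => hp.notMem_interior ((hconv a p).segment_subset
      (by simp only [mem_ofPred_eq, hap]; linarith)
      (by simpa only [mem_ofPred_eq, hbp] using hab) hx)
  have j₃ : LipJoined (interior Q)ᶜ _ (b + r • (p + q)) b :=
    .of_segment_subset fun x hx => hq.notMem_interior ((hconv b q).segment_subset
      (by simp only [mem_ofPred_eq, hbq]; linarith) (by simp) hx)
  refine ((j₁.trans j₂).trans j₃).mono subset_rfl ?_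
  have hru : ‖r • (p + q)‖ = 2 * dist a b / M := by
    rw [norm_smul, Real.norm_of_nonneg hr0, ← hM, hr]; field_simp
  rw [dist_self_add_right, dist_add_right, dist_self_add_left, hru]
  have : 2 * dist a b / M ≤ 2 * dist a b / m := by gcongr
  have e : dist a b * (1 + 4 / m) = 2 * dist a b / m + dist a b + 2 * dist a b / m := by ring
  linarith

/-- The metric projection onto a closed convex set. -/
theorem exists_lipschitz_retraction {Q : Set Plane} (hQ : Convex ℝ Q) (hc : IsClosed Q)
    (hne : Q.Nonempty) :
    ∃ f : Plane → Plane, LipschitzWith 1 f ∧ (∀ x ∈ Q, f x = x) ∧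
      MapsTo f (interior Q)ᶜ (Q \ interior Q) := by
  have hex : ∀ x : Plane, ∃ y ∈ Q, ∀ w ∈ Q, ⟪x - y, w - y⟫ ≤ 0 := fun x => by
    obtain ⟨y, hy, h⟩ := exists_norm_eq_iInf_of_complete_convex hne hc.isComplete hQ x
    exact ⟨y, hy, (norm_eq_iInf_iff_real_inner_le_zero hQ hy).1 h⟩
  choose f hfQ hf using hex
  refine ⟨f, LipschitzWith.of_dist_le_mul fun x y => ?_, fun x hx => ?_, fun x hx => ⟨hfQ x, ?_⟩⟩
  · have h₁ := hf x (f y) (hfQ y)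
    have h₂ := hf y (f x) (hfQ x)
    have h₃ : ‖f x - f y‖ ^ 2 ≤ ⟪x - y, f x - f y⟫ := by
      rw [← real_inner_self_eq_norm_sq]
      simp only [inner_sub_left, inner_sub_right] at h₁ h₂ ⊢
      linarith
    have h₄ := real_inner_le_norm (x - y) (f x - f y)
    simp only [NNReal.coe_one, one_mul, dist_eq_norm]
    by_contra! h
    nlinarith [norm_nonneg (x - y), norm_nonneg (f x - f y)]
  · have := hf x x hx
    rw [real_inner_self_eq_norm_sq] at this
    have h0 : ‖x - f x‖ = 0 := by nlinarith [norm_nonneg (x - f x)]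
    exact (sub_eq_zero.1 (norm_eq_zero.1 h0)).symm
  · by_cases h : x - f x = 0
    · rwa [← sub_eq_zero.1 h]
    · refine notMem_interior_of_forall_inner_le h fun w hw => ?_
      have := hf x w hw
      rw [real_inner_comm, inner_sub_left] at this
      linarith

theorem setWidth_le_of_unit {Q : Set Plane} (hQ : IsCompact Q) (hne : Q.Nonempty) {n : Plane}
    (hn : ‖n‖ = 1) {c : ℝ} (h : ∀ x ∈ Q, ∀ y ∈ Q, ⟪x, n⟫ - ⟪y, n⟫ ≤ c) : setWidth Q ≤ c := by
  have hcomp : ∀ v : Plane, IsCompact ((fun x => ⟪x, v⟫) '' Q) := fun v =>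
    hQ.image (by fun_prop)
  refine (ciInf_le ⟨0, ?_⟩ (⟨n, hn⟩ : {v : Plane // ‖v‖ = 1})).trans ?_
  · rintro _ ⟨v, rfl⟩
    exact sub_nonneg.2 (Real.sInf_le_sSup _ (hcomp v).bddBelow (hcomp v).bddAbove)
  · obtain ⟨x, hx, hx'⟩ := (hcomp n).sSup_mem (hne.image _)
    obtain ⟨y, hy, hy'⟩ := (hcomp n).sInf_mem (hne.image _)
    simp only [← hx', ← hy']
    exact h x hx y hy

theorem IsUnitNormalAt.setWidth_le {Q : Set Plane} (hQ : IsCompact Q) {a b p q : Plane}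
    (hp : IsUnitNormalAt Q a p) (hq : IsUnitNormalAt Q b q) :
    setWidth Q ≤ Metric.diam Q * ‖p + q‖ + dist a b := by
  refine setWidth_le_of_unit hQ ⟨a, hp.mem⟩ hp.norm_eq fun x hx y hy => ?_
  have h₁ := hp.inner_le x hx
  have h₂ := hq.inner_le y hy
  have h₃ := real_inner_le_norm (a - y) (p + q)
  have h₄ := real_inner_le_norm (b - a) q
  have h₅ : ‖a - y‖ * ‖p + q‖ ≤ Metric.diam Q * ‖p + q‖ := by
    rw [← dist_eq_norm]
    exact mul_le_mul_of_nonneg_right (Metric.dist_le_diam_of_mem hQ.isBounded hp.mem hy)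
      (norm_nonneg _)
  rw [hq.norm_eq, mul_one, ← dist_eq_norm, dist_comm] at h₄
  simp only [inner_sub_left, inner_add_right] at h₃ h₄
  linarith

theorem exists_unit_orthogonal_s13 (p q : Plane) (hp : ‖p‖ = 1) :
    ∃ v : Plane, ‖v‖ = 1 ∧ ⟪p, v⟫ = 0 ∧ 0 ≤ ⟪v, q⟫ := by
  obtain ⟨w, hw, hpw⟩ : ∃ w : Plane, ‖w‖ = 1 ∧ ⟪p, w⟫ = 0 := by
    refine ⟨!₂[-p 1, p 0], ?_, ?_⟩
    · rw [EuclideanSpace.norm_eq, Fin.sum_univ_two] at hp ⊢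
      simpa [add_comm] using hp
    · simp [PiLp.inner_apply, Fin.sum_univ_two, mul_comm]
  rcases le_total 0 ⟪w, q⟫ with h | h
  · exact ⟨w, hw, hpw, h⟩
  · exact ⟨-w, by simpa, by simpa, by simpa⟩

theorem one_le_norm_add_of_inner_nonneg {p q : Plane} (hp : ‖p‖ = 1) (h : 0 ≤ ⟪p, q⟫) :
    1 ≤ ‖p + q‖ := by
  have := norm_add_sq_real p q
  rw [hp] at this
  nlinarith [norm_nonneg (p + q), sq_nonneg ‖q‖]

/-- Two boundary points of a convex body are joined outside the interior by a path whose length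
is comparable to the diameter. -/
theorem IsUnitNormalAt.lipJoined_compl_diam {Q : Set Plane} (hQ : IsCompact Q) {a b p q : Plane}
    (hp : IsUnitNormalAt Q a p) (hq : IsUnitNormalAt Q b q) :
    LipJoined (interior Q)ᶜ (10 * Metric.diam Q) a b := by
  obtain ⟨v, hv, hpv, hvq⟩ := exists_unit_orthogonal_s13 p q hp.norm_eq
  obtain ⟨e, he, hmax⟩ := hQ.exists_isMaxOn ⟨a, hp.mem⟩
    (f := fun x => ⟪x, v⟫) (by fun_prop)
  have hev : IsUnitNormalAt Q e v := ⟨hv, he, hmax⟩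
  have j₁ := hp.lipJoined_compl hev one_pos
    (one_le_norm_add_of_inner_nonneg hp.norm_eq hpv.ge)
  have j₂ := hev.lipJoined_compl hq one_pos (one_le_norm_add_of_inner_nonneg hv hvq)
  refine (j₁.trans j₂).mono subset_rfl ?_
  have h₁ := Metric.dist_le_diam_of_mem hQ.isBounded hp.mem he
  have h₂ := Metric.dist_le_diam_of_mem hQ.isBounded he hq.mem
  linarith

/-- The boundary of a fat convex body has bounded distortion. -/
theorem lipJoined_boundary_of_fat {Q : Set Plane} (hQ : IsCompact Q) (hconv : Convex ℝ Q)
    (hne : (interior Q).Nonempty) {lam : ℝ} (hlam : lam ∈ Ioc (0 : ℝ) 1)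
    (hfat : lam * Metric.diam Q ≤ setWidth Q) {a b : Plane}
    (ha : a ∈ Q \ interior Q) (hb : b ∈ Q \ interior Q) :
    LipJoined (Q \ interior Q) (20 * lam⁻¹ * dist a b) a b := by
  obtain ⟨f, hf, hfQ, hmap⟩ := exists_lipschitz_retraction hconv hQ.isClosed ⟨a, ha.1⟩
  suffices h : LipJoined (interior Q)ᶜ (20 * lam⁻¹ * dist a b) a b by
    simpa only [hfQ a ha.1, hfQ b hb.1] using h.map hf hmap
  obtain ⟨p, hp⟩ := exists_isUnitNormalAt hconv hne ha.1 ha.2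
  obtain ⟨q, hq⟩ := exists_isUnitNormalAt hconv hne hb.1 hb.2
  obtain ⟨hl0, hl1⟩ := hlam
  have hinv : 1 ≤ lam⁻¹ := (one_le_inv₀ hl0).2 hl1
  rcases le_total (lam / 2) ‖p + q‖ with h | h
  · refine (hp.lipJoined_compl hq (half_pos hl0) h).mono subset_rfl ?_
    rw [mul_comm]
    refine mul_le_mul_of_nonneg_right ?_ dist_nonneg
    have : 4 / (lam / 2) = 8 * lam⁻¹ := by field_simp; norm_num
    linarith
  · refine (hp.lipJoined_compl_diam hQ hq).mono subset_rfl ?_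
    have h₁ := hp.setWidth_le hQ hq
    have h₂ := mul_le_mul_of_nonneg_left h (Metric.diam_nonneg (s := Q))
    have h₃ : lam * Metric.diam Q ≤ 2 * dist a b := by linarith
    calc 10 * Metric.diam Q = 10 * lam⁻¹ * (lam * Metric.diam Q) := by field_simp
      _ ≤ 10 * lam⁻¹ * (2 * dist a b) := by gcongr
      _ = 20 * lam⁻¹ * dist a b := by ring

/-- The first point of a closed set on a segment starting outside its interior. -/
theorem exists_first_hit {Q : Set Plane} (hQ : IsClosed Q) {s t : Plane} (hs : s ∉ interior Q)
    (h : (segment ℝ s t ∩ Q).Nonempty) :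
    ∃ a ∈ segment ℝ s t, a ∈ Q \ interior Q ∧ Disjoint (segment ℝ s a) (interior Q) := by
  have hcomp : IsCompact (segment ℝ s t ∩ Q) := by
    rw [segment_eq_image_lineMap]
    exact (isCompact_Icc.image AffineMap.lineMap_continuous).inter_right hQ
  obtain ⟨a, ⟨hat, haQ⟩, hmin⟩ := hcomp.exists_isMinOn h (f := fun x => dist s x) (by fun_prop)
  have honly : ∀ y ∈ segment ℝ s a, y ∈ Q → y = a := by
    intro y hy hyQ
    have h₁ : dist s a ≤ dist s y :=
      hmin ⟨(convex_segment s t).segment_subset (left_mem_segment ℝ s t) hat hy, hyQ⟩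
    have h₂ := dist_add_dist_of_mem_segment hy
    exact dist_le_zero.1 (by linarith)
  have hai : a ∉ interior Q := by
    intro hai
    have hsa : s ≠ a := fun e => hs (e ▸ hai)
    have hc : Filter.Tendsto (fun r : ℝ => AffineMap.lineMap a s r) (nhdsWithin 0 (Ioo 0 1))
        (nhds a) := by
      have : Continuous fun r : ℝ => AffineMap.lineMap a s r := AffineMap.lineMap_continuous
      simpa using (this.tendsto 0).mono_left nhdsWithin_le_nhds
    have : (nhdsWithin (0 : ℝ) (Ioo 0 1)).NeBot := left_nhdsWithin_Ioo_neBot one_pos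
    obtain ⟨r, hr, hr01⟩ := ((hc.eventually (isOpen_interior.mem_nhds hai)).and
      self_mem_nhdsWithin).exists
    have hmem : AffineMap.lineMap a s r ∈ segment ℝ s a := by
      rw [segment_symm, segment_eq_image_lineMap]
      exact ⟨r, ⟨hr01.1.le, hr01.2.le⟩, rfl⟩
    have := honly _ hmem (interior_subset hr)
    rw [AffineMap.lineMap_eq_left_iff] at this
    exact this.elim (fun e => hsa e.symm) hr01.1.ne'
  refine ⟨a, hat, ⟨haQ, hai⟩, Set.disjoint_left.2 fun y hy hyQ => hai ?_⟩
  rwa [← honly y hy (interior_subset hyQ)]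

/-- If the boundary of each of finitely many disjoint compact holes in a convex set has
distortion at most `K`, so has the domain. -/
theorem lipJoined_diff_iUnion_interior {ι : Type*} [Fintype ι] {P₀ : Set Plane} {Q : ι → Set Plane}
    (hP : Convex ℝ P₀) (hQ : ∀ i, IsClosed (Q i)) (hdisj : Pairwise (Function.onFun Disjoint Q))
    (hsub : ∀ i, Q i ⊆ P₀) {K : ℝ} (hK : 1 ≤ K)
    (hb : ∀ i, ∀ a ∈ Q i \ interior (Q i), ∀ b ∈ Q i \ interior (Q i),
      LipJoined (Q i \ interior (Q i)) (K * dist a b) a b)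
    {s t : Plane} (hs : s ∈ P₀ \ ⋃ i, interior (Q i)) (ht : t ∈ P₀ \ ⋃ i, interior (Q i)) :
    LipJoined (P₀ \ ⋃ i, interior (Q i)) (K * dist s t) s t := by
  have hbd : ∀ i, Q i \ interior (Q i) ⊆ P₀ \ ⋃ i, interior (Q i) := by
    rintro i x ⟨hx, hxi⟩
    refine ⟨hsub i hx, fun hxU => ?_⟩
    obtain ⟨j, hj⟩ := mem_iUnion.1 hxU
    rcases eq_or_ne i j with rfl | hij
    · exact hxi hj
    · exact Set.disjoint_left.1 (hdisj hij) hx (interior_subset hj)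
  induction hN : {i | ¬ Disjoint (segment ℝ s t) (interior (Q i))}.ncard using
    Nat.strong_induction_on generalizing s t with
  | _ N ih =>
  subst hN
  by_cases hfree : ∀ i, Disjoint (segment ℝ s t) (interior (Q i))
  · refine (LipJoined.of_segment_subset (P := P₀ \ ⋃ i, interior (Q i)) fun x hx =>
      ⟨hP.segment_subset hs.1 ht.1 hx, fun hxU => ?_⟩).mono subset_rfl
      (le_mul_of_one_le_left dist_nonneg hK)
    obtain ⟨i, hi⟩ := mem_iUnion.1 hxU
    exact Set.disjoint_left.1 (hfree i) hx hi
  push Not at hfree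
  obtain ⟨i, hi⟩ := hfree
  have hnot : ∀ {x}, x ∈ P₀ \ ⋃ i, interior (Q i) → x ∉ interior (Q i) :=
    fun hx hxi => hx.2 (mem_iUnion.2 ⟨i, hxi⟩)
  obtain ⟨a, hast, haQ, hsa⟩ := exists_first_hit (hQ i) (hnot hs)
    ((Set.not_disjoint_iff_nonempty_inter.1 hi).mono (inter_subset_inter_right _ interior_subset))
  obtain ⟨b, hbta, hbQ, htb⟩ := exists_first_hit (hQ i) (hnot ht)
    ⟨a, right_mem_segment ℝ t a, haQ.1⟩
  have sub₁ : segment ℝ s a ⊆ segment ℝ s t :=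
    (convex_segment s t).segment_subset (left_mem_segment ℝ s t) hast
  have sub₂ : segment ℝ b t ⊆ segment ℝ s t := by
    refine (convex_segment s t).segment_subset ?_ (right_mem_segment ℝ s t)
    exact (convex_segment s t).segment_subset (right_mem_segment ℝ s t) hast hbta
  have hlt : ∀ x y, segment ℝ x y ⊆ segment ℝ s t → Disjoint (segment ℝ x y) (interior (Q i)) →
      {j | ¬ Disjoint (segment ℝ x y) (interior (Q j))}.ncard <
        {j | ¬ Disjoint (segment ℝ s t) (interior (Q j))}.ncard := by
    intro x y hxy hd
    refine Set.ncard_lt_ncard ((Set.ssubset_iff_of_subset ?_).2 ⟨i, hi, fun h => h hd⟩)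
      (Set.toFinite _)
    exact fun j (hj : ¬ _) hj' => hj (hj'.mono_left hxy)
  have j₁ := ih _ (hlt s a sub₁ hsa) hs (hbd i haQ) rfl
  have j₂ := (hb i a haQ b hbQ).mono (hbd i) le_rfl
  have j₃ := ih _ (hlt b t sub₂ (by rwa [segment_symm ℝ b t])) (hbd i hbQ) ht rfl
  refine ((j₁.trans j₂).trans j₃).mono subset_rfl (le_of_eq ?_)
  have e₁ := dist_add_dist_of_mem_segment hast
  have e₂ := dist_add_dist_of_mem_segment hbta
  rw [dist_comm t b, dist_comm b a, dist_comm t a] at e₂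
  linear_combination K * e₁ + K * e₂

/-- There is an absolute constant `C > 0` such that for every `λ ∈ (0,1]` and
every polygonal domain `P = P₀ \ ⋃ᵢ interior Pᵢ` where the holes are pairwise disjoint `λ`-fat
convex polygons with nonempty interior inside the interior of the convex polygon `P₀`,
the geodesic diameter satisfies `diam_g(P) ≤ C·λ⁻¹·diam₂(P)`. -/
theorem fat_holes_geodesic_diameter :
    ∃ C : ℝ, 0 < C ∧
      ∀ (lam : ℝ), lam ∈ Set.Ioc (0 : ℝ) 1 →
        ∀ (h : ℕ) (P₀ : Set Plane) (Q : Fin h → Set Plane),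
          IsConvexPolygon P₀ →
          (∀ i, IsConvexPolygon (Q i)) →
          (∀ i, (interior (Q i)).Nonempty) →
          (∀ i, lam * Metric.diam (Q i) ≤ setWidth (Q i)) →
          Pairwise (Function.onFun Disjoint Q) →
          (∀ i, Q i ⊆ interior P₀) →
          geodDiam (P₀ \ ⋃ i, interior (Q i)) ≤
            ENNReal.ofReal
              (C * lam⁻¹ * Metric.diam (P₀ \ ⋃ i, interior (Q i))) := by
  refine ⟨20, by norm_num, fun lam hlam h P₀ Q hP₀ hQ hne hfat hdisj hsub => ?_⟩
  have hinv : 1 ≤ lam⁻¹ := (one_le_inv₀ hlam.1).2 hlam.2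
  refine iSup₂_le fun s hs => iSup₂_le fun t ht => ?_
  refine (lipJoined_diff_iUnion_interior hP₀.convex (fun i => (hQ i).isCompact.isClosed) hdisj
    (fun i => (hsub i).trans interior_subset) (K := 20 * lam⁻¹) (by linarith)
    (fun i a ha b hb => lipJoined_boundary_of_fat (hQ i).isCompact (hQ i).convex (hne i) hlam
      (hfat i) ha hb) hs ht).geod_le.trans (ENNReal.ofReal_le_ofReal ?_)
  exact mul_le_mul_of_nonneg_left
    (Metric.dist_le_diam_of_mem (hP₀.isCompact.isBounded.subset sdiff_subset) hs ht) (by linarith)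
end
end
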